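/- Let (q,r,α) be an admissible triple. Then there exists a constant C > 0 such that for every Schwartz function F on ℝ_t × ℝ_x, ‖∫_ℝ D^{α(1−2/r)} e^{i(t−t')∂_x⁴} F(t',·) dt'‖_{L_t^q L_x^r(ℝ×ℝ)} ≤ C ‖F‖_{L_t^{q'} L_x^{r'}(ℝ×ℝ)}, where 1/q + 1/q' = 1 and 1/r + 1/r' = 1. -/

import Mathlib

open MeasureTheory Complex
open scoped ENNReal

/-- The Fourier transform `û(ξ) = ∫ e^{-ixξ} u(x) dx`. -/
noncomputable def fourierInt (u : ℝ → ℂ) (ξ : ℝ) : ℂ :=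
  ∫ x : ℝ, Complex.exp (-(Complex.I * x * ξ)) * u x

/-- `(D^β e^{it∂_x⁴} u)(x) = (2π)⁻¹ ∫ |ξ|^β e^{i(xξ+tξ⁴)} û(ξ) dξ`. -/
noncomputable def DbihamGroup (β t : ℝ) (u : ℝ → ℂ) (x : ℝ) : ℂ :=
  (2 * Real.pi)⁻¹ * ∫ ξ : ℝ, ((|ξ| ^ β : ℝ) : ℂ) *
    Complex.exp (Complex.I * (x * ξ + t * ξ^4)) * fourierInt u ξ

/-- `(q,r,α)` is an admissible triple. -/
def Admissible (q r : ℝ≥0∞) (α : ℝ) : Prop :=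
  α ∈ Set.Icc (0:ℝ) 1 ∧ 2 ≤ r ∧ ENNReal.ofReal (8 / (1 + α)) ≤ q ∧
    4 / q + ENNReal.ofReal (1 + α) / r = ENNReal.ofReal ((1 + α) / 2)

/-- The mixed space-time norm `‖F‖_{L_t^q L_x^r}`. -/
noncomputable def mixedNorm (q r : ℝ≥0∞) (F : ℝ → ℝ → ℂ) : ℝ≥0∞ :=
  eLpNorm (fun t => (eLpNorm (F t) r volume).toReal) q volume

/-- Converse of Hölder's inequality, tested on bounded functions with support of finite measure. -/
theorem lintegral_rpow_le_of_forall_lintegral_mul_le {X : Type*} [MeasurableSpace X]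
    (μ : Measure X) [SigmaFinite μ] {q p : ℝ} (hqp : q.HolderConjugate p) {H : X → ℝ≥0∞}
    (hH : Measurable H) (K : ℝ≥0∞)
    (h : ∀ g : X → ℝ≥0∞, Measurable g → (∃ M : ℝ, ∀ x, g x ≤ ENNReal.ofReal M) →
      (∃ S : Set X, MeasurableSet S ∧ μ S < ∞ ∧ ∀ x ∉ S, g x = 0) →
      ∫⁻ x, H x * g x ∂μ ≤ K * (∫⁻ x, g x ^ p ∂μ) ^ (1 / p)) :
    (∫⁻ x, H x ^ q ∂μ) ^ (1 / q) ≤ K := by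
  have hq := hqp.pos
  have hp := hqp.symm.pos
  have hq1 : 0 < q - 1 := hqp.sub_one_pos
  set φ : ℕ → X → ℝ≥0∞ := fun n => (spanningSets μ n).indicator (fun x => min (H x) n) with hφ
  have hφm : ∀ n, Measurable (φ n) := fun n =>
    (hH.min measurable_const).indicator (measurableSet_spanningSets μ n)
  have hφH : ∀ n x, φ n x ≤ H x := by
    intro n x
    by_cases hx : x ∈ spanningSets μ n <;> simp [hφ, hx]
  have hφn : ∀ n x, φ n x ≤ n := by
    intro n x
    by_cases hx : x ∈ spanningSets μ n <;> simp [hφ, hx]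
  have hφ0 : ∀ n, ∀ x ∉ spanningSets μ n, φ n x = 0 := by
    intro n x hx
    simp [hφ, hx]
  have key : ∀ n, ∫⁻ x, φ n x ^ q ∂μ ≤ K ^ q := by
    intro n
    set I := ∫⁻ x, φ n x ^ q ∂μ with hI
    have hfin : I ≠ ∞ := by
      have : I ≤ ∫⁻ x, (spanningSets μ n).indicator (fun _ => (n : ℝ≥0∞) ^ q) x ∂μ := by
        refine lintegral_mono fun x => ?_
        by_cases hx : x ∈ spanningSets μ n
        · simp only [hx, Set.indicator_of_mem]
          exact ENNReal.rpow_le_rpow (hφn n x) hq.le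
        · simp [hx, hφ0 n x hx, hq]
      rw [lintegral_indicator_const (measurableSet_spanningSets μ n)] at this
      refine ne_top_of_le_ne_top ?_ this
      exact ENNReal.mul_ne_top (ENNReal.rpow_ne_top_of_nonneg hq.le (by simp))
        (measure_spanningSets_lt_top μ n).ne
    have h1 : I ≤ K * I ^ (1 / p) := by
      have := h (fun x => φ n x ^ (q - 1)) ((hφm n).pow_const _)
        ⟨(n : ℝ) ^ (q - 1), fun x => ?_⟩
        ⟨spanningSets μ n, measurableSet_spanningSets μ n, measure_spanningSets_lt_top μ n,
          fun x hx => by simp [hφ0 n x hx, hq1]⟩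
      · have e : ∀ x, (φ n x ^ (q - 1)) ^ p = φ n x ^ q := by
          intro x
          rw [← ENNReal.rpow_mul, hqp.sub_one_mul_conj]
        simp only [e] at this
        refine le_trans (lintegral_mono fun x => ?_) this
        calc φ n x ^ q = φ n x ^ (1 + (q - 1)) := by ring_nf
          _ = φ n x * φ n x ^ (q - 1) := by
            rw [ENNReal.rpow_add_of_nonneg _ _ zero_le_one hq1.le, ENNReal.rpow_one]
          _ ≤ _ := by gcongr; exact hφH n x
      · rw [← ENNReal.ofReal_rpow_of_nonneg (by positivity) hq1.le]
        simpa using ENNReal.rpow_le_rpow (hφn n x) hq1.le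
    rcases eq_or_ne I 0 with h0 | h0
    · rw [h0]; exact zero_le
    have h2 : I ^ (1 / q) ≤ K := by
      have e : I = I ^ (1 / q) * I ^ (1 / p) := by
        rw [← ENNReal.rpow_add _ _ h0 hfin]
        simp [hqp.inv_add_inv_eq_one]
      have hne : I ^ (1 / p) ≠ 0 := by
        simp [h0, hfin, hp]
      have hnt : I ^ (1 / p) ≠ ∞ := ENNReal.rpow_ne_top_of_nonneg (by positivity) hfin
      exact (ENNReal.mul_le_mul_iff_left hne hnt).1 (e.symm.le.trans h1)
    calc I = (I ^ (1 / q)) ^ q := by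
          rw [← ENNReal.rpow_mul, one_div, inv_mul_cancel₀ hq.ne', ENNReal.rpow_one]
      _ ≤ K ^ q := ENNReal.rpow_le_rpow h2 hq.le
  have hlim : ∀ x, Filter.Tendsto (fun n => φ n x) Filter.atTop (nhds (H x)) := by
    intro x
    have h1 : Filter.Tendsto (fun n : ℕ => min (H x) n) Filter.atTop (nhds (min (H x) ∞)) :=
      Filter.Tendsto.min tendsto_const_nhds ENNReal.tendsto_nat_nhds_top
    rw [min_eq_left le_top] at h1
    refine h1.congr' ?_
    obtain ⟨N, hN⟩ := Set.mem_iUnion.1 (iUnion_spanningSets μ ▸ Set.mem_univ x)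
    filter_upwards [Filter.eventually_ge_atTop N] with n hn
    have : x ∈ spanningSets μ n := monotone_spanningSets μ hn hN
    simp [hφ, this]
  have hF : ∫⁻ x, H x ^ q ∂μ ≤ K ^ q := by
    calc ∫⁻ x, H x ^ q ∂μ
        = ∫⁻ x, Filter.liminf (fun n => φ n x ^ q) Filter.atTop ∂μ := by
          refine lintegral_congr fun x => ?_
          exact (((ENNReal.continuous_rpow_const).tendsto _).comp (hlim x)).liminf_eq.symm
      _ ≤ Filter.liminf (fun n => ∫⁻ x, φ n x ^ q ∂μ) Filter.atTop :=
          lintegral_liminf_le fun n => (hφm n).pow_const _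
      _ ≤ Filter.liminf (fun _ : ℕ => K ^ q) Filter.atTop :=
          Filter.liminf_le_liminf (Filter.Eventually.of_forall key)
      _ = K ^ q := Filter.liminf_const _
  calc _ ≤ (K ^ q) ^ (1 / q) := ENNReal.rpow_le_rpow hF (by positivity)
    _ = K := by rw [← ENNReal.rpow_mul, mul_one_div_cancel hq.ne', ENNReal.rpow_one]

/-- Minkowski's integral inequality. -/
theorem lintegral_rpow_lintegral_le {T X : Type*} [MeasurableSpace T] [MeasurableSpace X]
    (ν : Measure T) [SFinite ν] (μ : Measure X) [SigmaFinite μ] {q : ℝ} (hq : 1 < q)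
    {G : T → X → ℝ≥0∞} (hG : Measurable (Function.uncurry G)) :
    (∫⁻ x, (∫⁻ t, G t x ∂ν) ^ q ∂μ) ^ (1 / q) ≤ ∫⁻ t, (∫⁻ x, G t x ^ q ∂μ) ^ (1 / q) ∂ν := by
  have hqp : q.HolderConjugate (q / (q - 1)) := Real.HolderConjugate.conjExponent hq
  have hG' : Measurable (Function.uncurry fun x t => G t x) := hG.comp measurable_swap
  refine lintegral_rpow_le_of_forall_lintegral_mul_le μ hqp hG'.lintegral_prod_right' _ ?_
  intro g hg _ _
  have hGx : ∀ t, Measurable (G t) := fun t => hG.comp measurable_prodMk_left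
  have hGt : ∀ x, Measurable (fun t => G t x) := fun x => hG.comp measurable_prodMk_right
  calc ∫⁻ x, (∫⁻ t, G t x ∂ν) * g x ∂μ = ∫⁻ x, ∫⁻ t, G t x * g x ∂ν ∂μ :=
        lintegral_congr fun x => (lintegral_mul_const _ (hGt x)).symm
    _ = ∫⁻ t, ∫⁻ x, G t x * g x ∂μ ∂ν := by
        refine lintegral_lintegral_swap ?_
        exact (hG'.mul (hg.comp measurable_fst)).aemeasurable
    _ ≤ ∫⁻ t, (∫⁻ x, G t x ^ q ∂μ) ^ (1 / q) *
          (∫⁻ x, g x ^ (q / (q - 1)) ∂μ) ^ (1 / (q / (q - 1))) ∂ν :=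
        lintegral_mono fun t =>
          ENNReal.lintegral_mul_le_Lp_mul_Lq μ hqp (hGx t).aemeasurable hg.aemeasurable
    _ = _ := by
        refine lintegral_mul_const _ ?_
        exact (Measurable.lintegral_prod_right' (hG.pow_const q)).pow_const _

theorem lintegral_comp_abs_le {φ : ℝ → ℝ} (h0 : ∀ x > 0, 0 ≤ φ x)
    (hi : IntegrableOn φ (Set.Ioi 0)) :
    ∫⁻ u : ℝ, ENNReal.ofReal (φ |u|) ≤ ENNReal.ofReal (2 * ∫ u in Set.Ioi 0, φ u) := by
  have hi' : Integrable (fun u : ℝ => φ |u|) := by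
    have hpos : IntegrableOn (fun u : ℝ => φ |u|) (Set.Ioi 0) :=
      hi.congr_fun (fun u hu => by simp [abs_of_pos (Set.mem_Ioi.1 hu)]) measurableSet_Ioi
    have hneg : IntegrableOn (fun u : ℝ => φ |u|) (Set.Iic 0) := by
      rw [← Measure.map_neg_eq_self (volume : Measure ℝ)]
      let m : MeasurableEmbedding fun x : ℝ => -x := (Homeomorph.neg ℝ).measurableEmbedding
      rw [m.integrableOn_map_iff]
      simpa [Function.comp_def, integrableOn_Ici_iff_integrableOn_Ioi] using hpos
    rw [← integrableOn_univ, ← Set.Iic_union_Ioi (a := (0 : ℝ))]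
    exact hneg.union hpos
  rw [← integral_comp_abs, ofReal_integral_eq_lintegral_ofReal hi']
  have : ∀ᵐ u : ℝ, u ≠ 0 := by simp [ae_iff]
  filter_upwards [this] with u hu using h0 _ (abs_pos.2 hu)

/-- The Riesz kernel `|u|^{-l}`. -/
noncomputable def rieszKernel (l u : ℝ) : ℝ≥0∞ := ENNReal.ofReal (|u| ^ (-l))

theorem measurable_rieszKernel (l : ℝ) : Measurable (rieszKernel l) := by
  unfold rieszKernel; fun_prop

theorem rieszKernel_sub_comm (l t s : ℝ) : rieszKernel l (t - s) = rieszKernel l (s - t) := by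
  rw [rieszKernel, rieszKernel, abs_sub_comm]

theorem lintegral_rieszKernel_near {l : ℝ} (hl : l < 1) {ρ : ℝ} (hρ : 0 < ρ) :
    ∫⁻ u : ℝ, {u : ℝ | |u| ≤ ρ}.indicator (rieszKernel l) u
      ≤ ENNReal.ofReal (2 * (ρ ^ (1 - l) / (1 - l))) := by
  have hi : IntegrableOn (fun u : ℝ => u ^ (-l)) (Set.Ioc 0 ρ) :=
    (intervalIntegrable_iff_integrableOn_Ioc_of_le hρ.le).1
      (intervalIntegral.intervalIntegrable_rpow' (by linarith))
  have hsub : Set.Ioi (0 : ℝ) ∩ Set.Iic ρ = Set.Ioc 0 ρ := Set.Ioi_inter_Iic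
  have h := lintegral_comp_abs_le (φ := (Set.Iic ρ).indicator fun u : ℝ => u ^ (-l)) ?_ ?_
  · rw [setIntegral_indicator measurableSet_Iic, hsub, ← intervalIntegral.integral_of_le hρ.le,
      integral_rpow (Or.inl (by linarith)), Real.zero_rpow (by linarith)] at h
    refine le_trans (le_of_eq (lintegral_congr fun u => ?_)) (h.trans (le_of_eq ?_))
    · by_cases hu : |u| ≤ ρ <;> simp [hu, rieszKernel]
    · rw [sub_zero, neg_add_eq_sub]
  · intro x hx
    exact Set.indicator_apply_nonneg fun _ => by positivity
  · rw [IntegrableOn, integrable_indicator_iff measurableSet_Iic, IntegrableOn,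
      Measure.restrict_restrict measurableSet_Iic, Set.inter_comm, hsub]
    exact hi

theorem lintegral_rieszKernel_far {ρ : ℝ} (hρ : 0 < ρ) :
    ∫⁻ u : ℝ, {u : ℝ | ρ < |u|}.indicator (rieszKernel 2) u ≤ ENNReal.ofReal (2 * ρ⁻¹) := by
  have hi : IntegrableOn (fun u : ℝ => u ^ (-2 : ℝ)) (Set.Ioi ρ) :=
    integrableOn_Ioi_rpow_of_lt (by norm_num) hρ
  have hsub : Set.Ioi (0 : ℝ) ∩ Set.Ioi ρ = Set.Ioi ρ := by
    rw [Set.Ioi_inter_Ioi, max_eq_right hρ.le]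
  have h := lintegral_comp_abs_le (φ := (Set.Ioi ρ).indicator fun u : ℝ => u ^ (-2 : ℝ)) ?_ ?_
  · rw [setIntegral_indicator measurableSet_Ioi, hsub,
      integral_Ioi_rpow_of_lt (by norm_num) hρ] at h
    refine le_trans (le_of_eq (lintegral_congr fun u => ?_)) (h.trans (le_of_eq ?_))
    · by_cases hu : ρ < |u| <;> simp [hu, rieszKernel]
    · norm_num [Real.rpow_neg_one]
  · intro x hx
    exact Set.indicator_apply_nonneg fun _ => by positivity
  · rw [IntegrableOn, integrable_indicator_iff measurableSet_Ioi, IntegrableOn,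
      Measure.restrict_restrict measurableSet_Ioi, Set.inter_comm, hsub]
    exact hi

theorem lintegral_rieszKernel_mul_truncation_le {q p : ℝ} (hqp : q.HolderConjugate p) (hq : 2 < q) :
    ∃ C : ℝ, 0 ≤ C ∧ ∀ g : ℝ → ℝ≥0∞, Measurable g → ∫⁻ s, g s ^ p ≤ 1 → ∀ (t : ℝ) (a : ℝ≥0∞),
      ∫⁻ s, rieszKernel (2 / q) (t - s) * {s | g s ≤ a}.indicator g s
        ≤ ENNReal.ofReal C * a ^ (p - 1) := by
  have hq0 := hqp.pos
  have hp0 := hqp.symm.pos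
  have hp1 : 0 < p - 1 := hqp.symm.sub_one_pos
  have hl : 2 / q < 1 := (div_lt_one hq0).2 hq
  have hpe : p = q / (q - 1) := hqp.conjugate_eq
  have hq1 : 0 < q - 1 := hqp.sub_one_pos
  refine ⟨2 / (1 - 2 / q) + 2 ^ (1 / q) , by have := sub_pos.2 hl; positivity, ?_⟩
  intro g hg hg1 t a
  rcases eq_or_ne a 0 with rfl | ha0
  · have : ∀ s, rieszKernel (2 / q) (t - s) * {s | g s ≤ 0}.indicator g s = 0 := by
      intro s
      by_cases hs : g s = 0 <;> simp [hs]
    simp_rw [this]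
    simp
  rcases eq_or_ne a ∞ with rfl | hat
  · rw [ENNReal.top_rpow_of_pos hp1, ENNReal.mul_top]
    · exact le_top
    · have := sub_pos.2 hl
      simp only [ne_eq, ENNReal.ofReal_eq_zero, not_le]; positivity
  obtain ⟨A, hA, rfl⟩ : ∃ A : ℝ, 0 < A ∧ a = ENNReal.ofReal A :=
    ⟨a.toReal, ENNReal.toReal_pos ha0 hat, (ENNReal.ofReal_toReal hat).symm⟩
  set ρ : ℝ := A ^ (-p) with hρd
  have hρ : 0 < ρ := Real.rpow_pos_of_pos hA _
  set kn : ℝ → ℝ≥0∞ := {u : ℝ | |u| ≤ ρ}.indicator (rieszKernel (2 / q))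
  set kf : ℝ → ℝ≥0∞ := {u : ℝ | ρ < |u|}.indicator (rieszKernel (2 / q))
  have hknm : Measurable kn :=
    (measurable_rieszKernel _).indicator (measurableSet_le measurable_norm measurable_const)
  have hkfm : Measurable kf :=
    (measurable_rieszKernel _).indicator (measurableSet_lt measurable_const measurable_norm)
  have hpt : ∀ s, rieszKernel (2 / q) (t - s) * {s | g s ≤ ENNReal.ofReal A}.indicator g s ≤
      kn (t - s) * ENNReal.ofReal A + kf (t - s) * g s := by
    intro s
    have h1 : {s | g s ≤ ENNReal.ofReal A}.indicator g s ≤ ENNReal.ofReal A := by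
      by_cases hs : g s ≤ ENNReal.ofReal A <;> simp [hs]
    have h2 : {s | g s ≤ ENNReal.ofReal A}.indicator g s ≤ g s := by
      by_cases hs : g s ≤ ENNReal.ofReal A <;> simp [hs]
    by_cases hu : |t - s| ≤ ρ
    · simp only [kn, kf, Set.indicator, Set.mem_ofPred_eq, hu, if_true, not_lt.2 hu, if_false,
        zero_mul, add_zero]
      gcongr
      simpa only [Set.indicator, Set.mem_ofPred_eq] using h1
    · simp only [kn, kf, Set.indicator, Set.mem_ofPred_eq, hu, if_true, not_le.1 hu, if_false,
        zero_mul, zero_add]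
      gcongr
      simpa only [Set.indicator, Set.mem_ofPred_eq] using h2
  have hfar : ∫⁻ s, kf (t - s) * g s ≤ ENNReal.ofReal (2 ^ (1 / q) * A ^ (p - 1)) := by
    calc ∫⁻ s, kf (t - s) * g s ≤
        (∫⁻ s, kf (t - s) ^ q) ^ (1 / q) * (∫⁻ s, g s ^ p) ^ (1 / p) :=
          ENNReal.lintegral_mul_le_Lp_mul_Lq _ hqp
            (hkfm.comp (measurable_const.sub measurable_id)).aemeasurable hg.aemeasurable
      _ ≤ (∫⁻ s, kf (t - s) ^ q) ^ (1 / q) * 1 := by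
          gcongr
          exact ENNReal.rpow_le_one hg1 (by positivity)
      _ = (∫⁻ u, kf u ^ q) ^ (1 / q) := by
          rw [mul_one, lintegral_sub_left_eq_self (fun u => kf u ^ q) t]
      _ ≤ (ENNReal.ofReal (2 * ρ⁻¹)) ^ (1 / q) := by
          refine ENNReal.rpow_le_rpow (le_trans (le_of_eq (lintegral_congr fun u => ?_))
            (lintegral_rieszKernel_far hρ)) (by positivity)
          by_cases hu : ρ < |u|
          · simp only [kf, Set.indicator, Set.mem_ofPred_eq, hu, if_true, rieszKernel]
            have hu0 : 0 < |u| := hρ.trans hu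
            rw [ENNReal.ofReal_rpow_of_nonneg (by positivity) hq0.le, ← Real.rpow_mul hu0.le]
            congr 2; field_simp
          · simp [kf, hu, hq0]
      _ = _ := by
          rw [ENNReal.ofReal_rpow_of_nonneg (by positivity) (by positivity),
            Real.mul_rpow (by positivity) (by positivity), hρd, ← Real.rpow_neg hA.le,
            ← Real.rpow_mul hA.le]
          congr 3
          rw [hpe]; field_simp; ring
  have hnear : ∫⁻ s, kn (t - s) * ENNReal.ofReal A ≤
      ENNReal.ofReal (2 / (1 - 2 / q) * A ^ (p - 1)) := by
    rw [lintegral_mul_const _ (f := fun s => kn (t - s)) (hknm.comp (measurable_const.sub measurable_id)),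
      lintegral_sub_left_eq_self kn t]
    calc _ ≤ ENNReal.ofReal (2 * (ρ ^ (1 - 2 / q) / (1 - 2 / q))) * ENNReal.ofReal A := by
          gcongr; exact lintegral_rieszKernel_near hl hρ
      _ = _ := by
          have := sub_pos.2 hl
          rw [← ENNReal.ofReal_mul (by positivity)]
          congr 1
          have e : A ^ (p - 1) = ρ ^ (1 - 2 / q) * A := by
            rw [hρd, ← Real.rpow_mul hA.le]
            nth_rewrite 3 [← Real.rpow_one A]
            rw [← Real.rpow_add hA]
            congr 1
            rw [hpe]; field_simp; ring
          rw [e]; ring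
  calc _ ≤ ∫⁻ s, (kn (t - s) * ENNReal.ofReal A + kf (t - s) * g s) := lintegral_mono hpt
    _ = (∫⁻ s, kn (t - s) * ENNReal.ofReal A) + ∫⁻ s, kf (t - s) * g s :=
        lintegral_add_left ((hknm.comp (measurable_const.sub measurable_id)).mul_const _) _
    _ ≤ _ := add_le_add hnear hfar
    _ = _ := by
        have := sub_pos.2 hl
        rw [ENNReal.ofReal_rpow_of_nonneg hA.le hp1.le, ← ENNReal.ofReal_mul (by positivity),
          ← ENNReal.ofReal_add (by positivity) (by positivity), add_mul]

theorem lintegral_mul_rieszKernel_mul_le_of_le_one {q p : ℝ} (hqp : q.HolderConjugate p)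
    (hq : 2 < q) : ∃ C : ℝ, 0 ≤ C ∧ ∀ f g : ℝ → ℝ≥0∞, Measurable f → Measurable g →
      ∫⁻ s, f s ^ p ≤ 1 → ∫⁻ s, g s ^ p ≤ 1 →
      ∫⁻ t, ∫⁻ s, f t * rieszKernel (2 / q) (t - s) * g s ≤ ENNReal.ofReal C := by
  obtain ⟨C, hC, h⟩ := lintegral_rieszKernel_mul_truncation_le hqp hq
  refine ⟨C + C, by positivity, fun f g hf hg hf1 hg1 => ?_⟩
  have half : ∀ f g : ℝ → ℝ≥0∞, Measurable f → Measurable g →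
      ∫⁻ s, f s ^ p ≤ 1 → ∫⁻ s, g s ^ p ≤ 1 →
      ∫⁻ t, ∫⁻ s, f t * (rieszKernel (2 / q) (t - s) * {s | g s ≤ f t}.indicator g s)
        ≤ ENNReal.ofReal C := by
    intro f g hf hg hf1 hg1
    calc _ ≤ ∫⁻ t, ENNReal.ofReal C * f t ^ p := by
          refine lintegral_mono fun t => ?_
          rw [lintegral_const_mul _ (f := fun s => rieszKernel (2 / q) (t - s) *
              {s | g s ≤ f t}.indicator g s)
            (((measurable_rieszKernel _).comp (measurable_const.sub measurable_id)).mul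
              (hg.indicator (measurableSet_le hg measurable_const)))]
          calc _ ≤ f t * (ENNReal.ofReal C * f t ^ (p - 1)) := by gcongr; exact h g hg hg1 t _
            _ = ENNReal.ofReal C * (f t ^ (1 : ℝ) * f t ^ (p - 1)) := by
                rw [ENNReal.rpow_one]; ring
            _ = _ := by
                rw [← ENNReal.rpow_add_of_nonneg _ _ zero_le_one hqp.symm.sub_one_pos.le]
                ring_nf
      _ = ENNReal.ofReal C * ∫⁻ t, f t ^ p := lintegral_const_mul _ (hf.pow_const _)
      _ ≤ ENNReal.ofReal C * 1 := by gcongr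
      _ = _ := mul_one _
  have hm : ∀ f g : ℝ → ℝ≥0∞, Measurable f → Measurable g → Measurable fun z : ℝ × ℝ =>
      f z.1 * (rieszKernel (2 / q) (z.1 - z.2) * {s | g s ≤ f z.1}.indicator g z.2) := by
    intro f g hf hg
    refine (hf.comp measurable_fst).mul
      (((measurable_rieszKernel _).comp (measurable_fst.sub measurable_snd)).mul ?_)
    exact Measurable.indicator (s := {z : ℝ × ℝ | g z.2 ≤ f z.1}) (f := fun z => g z.2)
      (hg.comp measurable_snd)
      (measurableSet_le (hg.comp measurable_snd) (hf.comp measurable_fst))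
  calc _ ≤ ∫⁻ t, ∫⁻ s, (f t * (rieszKernel (2 / q) (t - s) * {s | g s ≤ f t}.indicator g s) +
        g s * (rieszKernel (2 / q) (s - t) * {t | f t ≤ g s}.indicator f t)) := by
        refine lintegral_mono fun t => lintegral_mono fun s => ?_
        rcases le_total (g s) (f t) with hs | hs
        · refine le_trans (le_of_eq ?_) le_self_add
          simp [hs, mul_assoc]
        · refine le_trans (le_of_eq ?_) le_add_self
          simp only [Set.indicator, Set.mem_ofPred_eq, hs, if_true]
          rw [rieszKernel_sub_comm]; ring
    _ = (∫⁻ t, ∫⁻ s, f t * (rieszKernel (2 / q) (t - s) * {s | g s ≤ f t}.indicator g s)) +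
        ∫⁻ t, ∫⁻ s, g s * (rieszKernel (2 / q) (s - t) * {t | f t ≤ g s}.indicator f t) := by
        rw [← lintegral_add_left (Measurable.lintegral_prod_right' (hm f g hf hg))]
        refine lintegral_congr fun t => ?_
        exact lintegral_add_left ((hm f g hf hg).comp measurable_prodMk_left) _
    _ ≤ ENNReal.ofReal C + ENNReal.ofReal C := by
        refine add_le_add (half f g hf hg hf1 hg1) ?_
        rw [lintegral_lintegral_swap (f := fun t s => g s * (rieszKernel (2 / q) (s - t) *
          {t | f t ≤ g s}.indicator f t)) ((hm g f hg hf).comp measurable_swap).aemeasurable]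
        exact half g f hg hf hg1 hf1
    _ = _ := (ENNReal.ofReal_add hC hC).symm

/-- The Hardy–Littlewood–Sobolev inequality on the line, between dual exponents. -/
theorem hardy_littlewood_sobolev {q p : ℝ} (hqp : q.HolderConjugate p) (hq : 2 < q) :
    ∃ C : ℝ, 0 ≤ C ∧ ∀ f : ℝ → ℝ≥0∞, Measurable f → ∫⁻ s, f s ^ p ≠ ∞ →
      (∫⁻ t, (∫⁻ s, rieszKernel (2 / q) (t - s) * f s) ^ q) ^ (1 / q) ≤
        ENNReal.ofReal C * (∫⁻ s, f s ^ p) ^ (1 / p) := by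
  obtain ⟨C, hC, h⟩ := lintegral_mul_rieszKernel_mul_le_of_le_one hqp hq
  have hp0 := hqp.symm.pos
  refine ⟨C, hC, fun f hf hft => ?_⟩
  have hm : ∀ f : ℝ → ℝ≥0∞, Measurable f → Measurable fun z : ℝ × ℝ =>
      rieszKernel (2 / q) (z.1 - z.2) * f z.2 := fun f hf =>
    ((measurable_rieszKernel _).comp (measurable_fst.sub measurable_snd)).mul
      (hf.comp measurable_snd)
  have hnorm : ∀ f : ℝ → ℝ≥0∞, Measurable f → ∫⁻ s, f s ^ p ≠ ∞ → ∫⁻ s, f s ^ p ≠ 0 →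
      ∫⁻ s, (((∫⁻ s, f s ^ p) ^ (1 / p))⁻¹ * f s) ^ p ≤ 1 := by
    intro f hf h1 h2
    refine le_of_eq ?_
    simp_rw [ENNReal.mul_rpow_of_nonneg _ _ hp0.le]
    rw [lintegral_const_mul _ (hf.pow_const _), ENNReal.inv_rpow, ← ENNReal.rpow_mul,
      one_div_mul_cancel hp0.ne', ENNReal.rpow_one, ENNReal.inv_mul_cancel h2 h1]
  have hzero : ∀ f : ℝ → ℝ≥0∞, Measurable f → ∫⁻ s, f s ^ p = 0 → ∀ᵐ s, f s = 0 := by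
    intro f hf h1
    rw [lintegral_eq_zero_iff (hf.pow_const _)] at h1
    filter_upwards [h1] with s hs
    simpa [hp0, hp0.not_gt] using hs
  refine lintegral_rpow_le_of_forall_lintegral_mul_le _ hqp
    (Measurable.lintegral_prod_right' (hm f hf)) _ fun g hg ⟨M, hM⟩ ⟨S, _, hS, hgS⟩ => ?_
  have hgt : ∫⁻ s, g s ^ p ≠ ∞ := by
    have hle : ∫⁻ s, g s ^ p ≤ ∫⁻ s, S.indicator (fun _ => ENNReal.ofReal M ^ p) s := by
      refine lintegral_mono fun s => ?_
      by_cases hs : s ∈ S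
      · simp only [hs, Set.indicator_of_mem]
        exact ENNReal.rpow_le_rpow (hM s) hp0.le
      · simp [hs, hgS s hs, hp0]
    refine ne_top_of_le_ne_top ?_ (hle.trans (lintegral_indicator_const_le _ _))
    exact ENNReal.mul_ne_top (ENNReal.rpow_ne_top_of_nonneg hp0.le ENNReal.ofReal_ne_top) hS.ne
  rcases eq_or_ne (∫⁻ s, f s ^ p) 0 with hf0 | hf0
  · have : ∀ t, ∫⁻ s, rieszKernel (2 / q) (t - s) * f s = 0 := by
      intro t
      refine lintegral_eq_zero_of_ae_eq_zero ?_
      filter_upwards [hzero f hf hf0] with s hs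
      simp [hs]
    simp [this]
  rcases eq_or_ne (∫⁻ s, g s ^ p) 0 with hg0 | hg0
  · refine le_trans (le_of_eq ?_) (zero_le (a := _))
    refine lintegral_eq_zero_of_ae_eq_zero ?_
    filter_upwards [hzero g hg hg0] with s hs
    simp [hs]
  set A := (∫⁻ s, f s ^ p) ^ (1 / p) with hA
  set B := (∫⁻ s, g s ^ p) ^ (1 / p) with hB
  have hA0 : A ≠ 0 := by simp [hA, hf0, hft, hp0]
  have hB0 : B ≠ 0 := by simp [hB, hg0, hgt, hp0]
  have hAt : A ≠ ∞ := ENNReal.rpow_ne_top_of_nonneg (by positivity) hft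
  have hBt : B ≠ ∞ := ENNReal.rpow_ne_top_of_nonneg (by positivity) hgt
  have key := h (fun t => B⁻¹ * g t) (fun t => A⁻¹ * f t) (hg.const_mul _) (hf.const_mul _)
    (hnorm g hg hgt hg0) (hnorm f hf hft hf0)
  have e : ∫⁻ t, ∫⁻ s, (B⁻¹ * g t) * rieszKernel (2 / q) (t - s) * (A⁻¹ * f s) =
      B⁻¹ * A⁻¹ * ∫⁻ t, (∫⁻ s, rieszKernel (2 / q) (t - s) * f s) * g t := by
    have hmI : Measurable fun t => ∫⁻ s, rieszKernel (2 / q) (t - s) * f s :=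
      Measurable.lintegral_prod_right' (hm f hf)
    rw [← lintegral_const_mul (f := fun t => (∫⁻ s, rieszKernel (2 / q) (t - s) * f s) * g t) _
      (hmI.mul hg)]
    refine lintegral_congr fun t => ?_
    have hmt : Measurable fun s => rieszKernel (2 / q) (t - s) * f s :=
      ((measurable_rieszKernel _).comp (measurable_const.sub measurable_id)).mul hf
    calc _ = ∫⁻ s, B⁻¹ * A⁻¹ * g t * (rieszKernel (2 / q) (t - s) * f s) :=
          lintegral_congr fun s => by ring
      _ = B⁻¹ * A⁻¹ * g t * ∫⁻ s, rieszKernel (2 / q) (t - s) * f s := lintegral_const_mul _ hmt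
      _ = _ := by ring
  rw [e] at key
  calc _ = A * B * (B⁻¹ * A⁻¹ * ∫⁻ t, (∫⁻ s, rieszKernel (2 / q) (t - s) * f s) * g t) := by
        rw [← mul_assoc, show A * B * (B⁻¹ * A⁻¹) = (A * A⁻¹) * (B * B⁻¹) by ring,
          ENNReal.mul_inv_cancel hA0 hAt, ENNReal.mul_inv_cancel hB0 hBt, one_mul, one_mul]
    _ ≤ A * B * ENNReal.ofReal C := by gcongr
    _ = _ := by ring

theorem norm_cexp_neg_I_mul (x ξ : ℝ) : ‖cexp (-(I * x * ξ))‖ = 1 := by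
  rw [show -(I * x * ξ) = ((-(x * ξ) : ℝ) : ℂ) * I by push_cast; ring, norm_exp_ofReal_mul_I]

theorem continuous_fourierInt {f : ℝ → ℂ} (hf : Integrable f) : Continuous (fourierInt f) := by
  unfold fourierInt
  refine continuous_of_dominated (bound := fun x => ‖f x‖) (fun ξ => ?_) (fun ξ => ?_) hf.norm ?_
  · exact (Continuous.aestronglyMeasurable (by fun_prop)).mul hf.1
  · refine Filter.Eventually.of_forall fun x => ?_
    rw [norm_mul, norm_cexp_neg_I_mul, one_mul]
  · exact Filter.Eventually.of_forall fun x => by fun_prop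

theorem norm_fourierInt_le (f : ℝ → ℂ) (ξ : ℝ) : ‖fourierInt f ξ‖ ≤ ∫ x, ‖f x‖ := by
  refine (norm_integral_le_integral_norm _).trans (le_of_eq (integral_congr_ae ?_))
  refine Filter.Eventually.of_forall fun x => ?_
  simp only [norm_mul, norm_cexp_neg_I_mul, one_mul]

theorem norm_integral_gaussian_mul {ε : ℝ} (hε : 0 < ε) (u : ℝ) :
    ‖∫ ξ : ℝ, cexp (-(I * u * ξ)) * cexp (-ε * ξ ^ 2)‖ =
      Real.sqrt (Real.pi / ε) * Real.exp (-(1 / (4 * ε)) * u ^ 2) := by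
  have h := fourierIntegral_gaussian (b := (ε : ℂ)) (by simpa using hε) (-(u : ℂ))
  have e : ∀ ξ : ℝ, cexp (-(I * u * ξ)) * cexp (-ε * ξ ^ 2) =
      cexp (I * -(u : ℂ) * ξ) * cexp (-ε * ξ ^ 2) := fun ξ => by ring_nf
  simp_rw [e]
  rw [h, norm_mul, Complex.norm_exp]
  congr 1
  · rw [← ofReal_div, Complex.norm_cpow_eq_rpow_re_of_pos (by positivity), Real.sqrt_eq_rpow]
    norm_num
  · rw [show -(-(u : ℂ)) ^ 2 / (4 * ε) = ((-(1 / (4 * ε)) * u ^ 2 : ℝ) : ℂ) by push_cast; ring,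
      ofReal_re]

/-- A local form of the upper bound in Plancherel's theorem. -/
theorem lintegral_Icc_fourierInt_sq_le {f : ℝ → ℂ} (hf : Integrable f) (R : ℝ) :
    ∫⁻ ξ in Set.Icc (-R) R, ‖fourierInt f ξ‖ₑ ^ 2 ≤
      ENNReal.ofReal (4 * Real.pi * Real.exp 1) * ∫⁻ x, ‖f x‖ₑ ^ 2 := by
  set ε : ℝ := (R ^ 2 + 1)⁻¹ with hε
  have hε0 : 0 < ε := by positivity
  set w : ℝ → ℂ := fun ξ => cexp (-ε * ξ ^ 2) with hw
  have hwr : ∀ ξ : ℝ, w ξ = (Real.exp (-ε * ξ ^ 2) : ℝ) := fun ξ => by simp [hw]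
  have hwc : Continuous w := by fun_prop
  have hwi : Integrable w := by
    rw [funext hwr]
    exact (integrable_exp_neg_mul_sq hε0).ofReal (𝕜 := ℂ)
  set H := fourierInt f with hH
  have hHc : Continuous H := continuous_fourierInt hf
  have hconj : ∀ ξ, (starRingEnd ℂ) (H ξ) = ∫ y : ℝ, cexp (I * y * ξ) * (starRingEnd ℂ) (f y) := by
    intro ξ
    rw [hH, fourierInt, ← integral_conj (𝕜 := ℂ)]
    refine integral_congr_ae (Filter.Eventually.of_forall fun y => ?_)
    simp [← Complex.exp_conj]
  have hfc : Integrable fun y => (starRingEnd ℂ) (f y) :=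
    (memLp_one_iff_integrable.1 (memLp_one_iff_integrable.2 hf).star)
  have hprod : Integrable (fun z : ℝ × ℝ => f z.1 * (starRingEnd ℂ) (f z.2)) := hf.mul_prod hfc
  have hint : Integrable (Function.uncurry fun (ξ : ℝ) (z : ℝ × ℝ) =>
      cexp (-(I * (z.1 - z.2 : ℝ) * ξ)) * w ξ * (f z.1 * (starRingEnd ℂ) (f z.2))) := by
    have := hwi.mul_prod hprod
    refine (this.bdd_mul (c := 1) (f := fun v : ℝ × (ℝ × ℝ) =>
      cexp (-(I * (v.2.1 - v.2.2 : ℝ) * v.1))) ?_ ?_).congr ?_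
    · exact Continuous.aestronglyMeasurable (by fun_prop)
    · exact Filter.Eventually.of_forall fun v => (norm_cexp_neg_I_mul _ _).le
    · exact Filter.Eventually.of_forall fun v => by simp [Function.uncurry, mul_assoc]
  have hexp : ∀ ξ : ℝ, H ξ * (starRingEnd ℂ) (H ξ) * w ξ =
      ∫ z : ℝ × ℝ, cexp (-(I * (z.1 - z.2 : ℝ) * ξ)) * w ξ * (f z.1 * (starRingEnd ℂ) (f z.2)) := by
    intro ξ
    rw [hconj, hH, fourierInt, ← integral_prod_mul, ← integral_mul_const]
    refine integral_congr_ae (Filter.Eventually.of_forall fun z => ?_)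
    have : cexp (-(I * (z.1 - z.2 : ℝ) * ξ)) = cexp (-(I * z.1 * ξ)) * cexp (I * z.2 * ξ) := by
      rw [← Complex.exp_add]; push_cast; ring_nf
    simp only [this]; ring
  set κ : ℝ → ℝ := fun u => Real.sqrt (Real.pi / ε) * Real.exp (-(1 / (4 * ε)) * u ^ 2) with hκ
  have hκ0 : ∀ u, 0 ≤ κ u := fun u => by positivity
  have hκm : Measurable fun u => ENNReal.ofReal (κ u) := by fun_prop
  have hκi : ∫⁻ u, ENNReal.ofReal (κ u) = ENNReal.ofReal (2 * Real.pi) := by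
    have hi := integrable_exp_neg_mul_sq (b := 1 / (4 * ε)) (by positivity)
    rw [← ofReal_integral_eq_lintegral_ofReal (hi.const_mul _)
      (Filter.Eventually.of_forall hκ0), integral_const_mul, integral_gaussian,
      ← Real.sqrt_mul (by positivity)]
    congr 1
    rw [show Real.pi / ε * (Real.pi / (1 / (4 * ε))) = (2 * Real.pi) ^ 2 by field_simp; ring]
    exact Real.sqrt_sq (by positivity)
  have hfm : AEMeasurable (fun x => ‖f x‖ₑ ^ 2) := hf.1.enorm.pow_const 2
  have hside1 : ∫⁻ z : ℝ × ℝ, ‖f z.1‖ₑ ^ 2 * ENNReal.ofReal (κ (z.1 - z.2)) =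
      ENNReal.ofReal (2 * Real.pi) * ∫⁻ x, ‖f x‖ₑ ^ 2 := by
    rw [Measure.volume_eq_prod, lintegral_prod _ (by
      exact hfm.comp_fst.mul (hκm.comp (measurable_fst.sub measurable_snd)).aemeasurable)]
    have : ∀ x : ℝ, ∫⁻ y, ‖f x‖ₑ ^ 2 * ENNReal.ofReal (κ (x - y)) =
        ENNReal.ofReal (2 * Real.pi) * ‖f x‖ₑ ^ 2 := by
      intro x
      rw [lintegral_const_mul' _ _ (by simp), lintegral_sub_left_eq_self (fun u =>
        ENNReal.ofReal (κ u)), hκi, mul_comm]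
    simp_rw [this]
    rw [lintegral_const_mul' _ _ ENNReal.ofReal_ne_top]
  have hside2 : ∫⁻ z : ℝ × ℝ, ‖f z.2‖ₑ ^ 2 * ENNReal.ofReal (κ (z.1 - z.2)) =
      ENNReal.ofReal (2 * Real.pi) * ∫⁻ x, ‖f x‖ₑ ^ 2 := by
    rw [← hside1, Measure.volume_eq_prod, ← lintegral_prod_swap]
    refine lintegral_congr fun z => ?_
    simp only [Prod.fst_swap, Prod.snd_swap, hκ]
    rw [← neg_sub z.1 z.2, neg_sq]
  have hmain : ‖∫ ξ, H ξ * (starRingEnd ℂ) (H ξ) * w ξ‖ₑ ≤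
      ENNReal.ofReal (4 * Real.pi) * ∫⁻ x, ‖f x‖ₑ ^ 2 := by
    simp_rw [hexp]
    rw [integral_integral_swap hint]
    calc _ ≤ ∫⁻ z : ℝ × ℝ, ‖∫ ξ : ℝ, cexp (-(I * (z.1 - z.2 : ℝ) * ξ)) * w ξ *
            (f z.1 * (starRingEnd ℂ) (f z.2))‖ₑ := enorm_integral_le_lintegral_enorm _
      _ = ∫⁻ z : ℝ × ℝ, ENNReal.ofReal (κ (z.1 - z.2)) * (‖f z.1‖ₑ * ‖f z.2‖ₑ) := by
          refine lintegral_congr fun z => ?_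
          rw [integral_mul_const, enorm_mul, ← ofReal_norm,
            norm_integral_gaussian_mul hε0, enorm_mul, RCLike.enorm_conj]
      _ ≤ ∫⁻ z : ℝ × ℝ, (‖f z.1‖ₑ ^ 2 * ENNReal.ofReal (κ (z.1 - z.2)) +
            ‖f z.2‖ₑ ^ 2 * ENNReal.ofReal (κ (z.1 - z.2))) := by
          refine lintegral_mono fun z => ?_
          rw [← add_mul, mul_comm]
          gcongr
          rcases le_total ‖f z.1‖ₑ ‖f z.2‖ₑ with h | h
          · exact le_trans (by rw [sq]; gcongr) le_add_self
          · exact le_trans (by rw [sq]; gcongr) le_self_add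
      _ = _ := by
          rw [lintegral_add_left' (by
            exact hfm.comp_fst.mul (hκm.comp (measurable_fst.sub measurable_snd)).aemeasurable),
            hside1, hside2, ← add_mul, ← ENNReal.ofReal_add (by positivity) (by positivity)]
          congr 2; ring
  have hsq : ∀ ξ, H ξ * (starRingEnd ℂ) (H ξ) * w ξ =
      ((‖H ξ‖ ^ 2 * Real.exp (-ε * ξ ^ 2) : ℝ) : ℂ) := by
    intro ξ
    rw [Complex.mul_conj, hwr, Complex.normSq_eq_norm_sq]; push_cast; ring
  have hri : Integrable fun ξ => ‖H ξ‖ ^ 2 * Real.exp (-ε * ξ ^ 2) := by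
    refine (integrable_exp_neg_mul_sq hε0).bdd_mul (c := (∫ x, ‖f x‖) ^ 2)
      (by fun_prop) (Filter.Eventually.of_forall fun ξ => ?_)
    rw [norm_pow, norm_norm]
    exact pow_le_pow_left₀ (norm_nonneg _) (norm_fourierInt_le f ξ) 2
  have heq : ‖∫ ξ, H ξ * (starRingEnd ℂ) (H ξ) * w ξ‖ₑ =
      ∫⁻ ξ, ENNReal.ofReal (‖H ξ‖ ^ 2 * Real.exp (-ε * ξ ^ 2)) := by
    simp_rw [hsq]
    have h0 : ∀ ξ, 0 ≤ ‖H ξ‖ ^ 2 * Real.exp (-ε * ξ ^ 2) := fun ξ => by positivity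
    rw [integral_complex_ofReal, ← ofReal_norm, Complex.norm_real, Real.norm_of_nonneg
      (integral_nonneg h0),
      ofReal_integral_eq_lintegral_ofReal hri (Filter.Eventually.of_forall h0)]
  rw [heq] at hmain
  calc ∫⁻ ξ in Set.Icc (-R) R, ‖H ξ‖ₑ ^ 2
      ≤ ∫⁻ ξ in Set.Icc (-R) R, ENNReal.ofReal (Real.exp 1) *
          ENNReal.ofReal (‖H ξ‖ ^ 2 * Real.exp (-ε * ξ ^ 2)) := by
        refine setLIntegral_mono' measurableSet_Icc fun ξ hξ => ?_
        rw [← ENNReal.ofReal_mul (by positivity), ← ofReal_norm,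
          ← ENNReal.ofReal_pow (norm_nonneg _)]
        refine ENNReal.ofReal_le_ofReal ?_
        have h1 : 1 ≤ Real.exp 1 * Real.exp (-ε * ξ ^ 2) := by
          rw [← Real.exp_add]
          refine Real.one_le_exp ?_
          have : ξ ^ 2 ≤ R ^ 2 := sq_le_sq' hξ.1 hξ.2
          have : ε * ξ ^ 2 ≤ 1 := by
            rw [hε, inv_mul_le_one₀ (by positivity)]; linarith
          linarith
        nlinarith [sq_nonneg ‖H ξ‖]
    _ ≤ ∫⁻ ξ, ENNReal.ofReal (Real.exp 1) *
          ENNReal.ofReal (‖H ξ‖ ^ 2 * Real.exp (-ε * ξ ^ 2)) := setLIntegral_le_lintegral _ _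
    _ = ENNReal.ofReal (Real.exp 1) * ∫⁻ ξ,
          ENNReal.ofReal (‖H ξ‖ ^ 2 * Real.exp (-ε * ξ ^ 2)) :=
        lintegral_const_mul' _ _ ENNReal.ofReal_ne_top
    _ ≤ ENNReal.ofReal (Real.exp 1) * (ENNReal.ofReal (4 * Real.pi) * ∫⁻ x, ‖f x‖ₑ ^ 2) := by
        gcongr
    _ = _ := by
        rw [← mul_assoc, ← ENNReal.ofReal_mul (by positivity)]
        congr 2; ring

theorem norm_cexp_mul_log {w : ℂ} {ξ : ℝ} (hξ : 0 < ξ) : ‖cexp (w * Real.log ξ)‖ = ξ ^ w.re := by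
  rw [Complex.norm_exp, re_mul_ofReal, Real.rpow_def_of_pos hξ, mul_comm]

/-- The model oscillatory integrand `ξ ^ w * e^{i (x ξ + ξ ^ 4)}`. -/
noncomputable def quarticIntegrand (w : ℂ) (x ξ : ℝ) : ℂ :=
  cexp (w * Real.log ξ) * cexp (I * (x * ξ + ξ ^ 4))

theorem norm_cexp_I_phase (x t ξ : ℝ) : ‖cexp (I * (x * ξ + t * ξ ^ 4))‖ = 1 := by
  rw [show I * ((x : ℂ) * ξ + t * ξ ^ 4) = ((x * ξ + t * ξ ^ 4 : ℝ) : ℂ) * I by push_cast; ring,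
    norm_exp_ofReal_mul_I]

theorem norm_quarticIntegrand {w : ℂ} {x ξ : ℝ} (hξ : 0 < ξ) :
    ‖quarticIntegrand w x ξ‖ = ξ ^ w.re := by
  have := norm_cexp_I_phase x 1 ξ
  simp only [ofReal_one, one_mul] at this
  rw [quarticIntegrand, norm_mul, norm_cexp_mul_log hξ, this, mul_one]

/-- Integration by parts away from the stationary point of the phase. -/
theorem norm_integral_quarticIntegrand_le {w : ℂ} (hw1 : w.re ≤ 1) {x a b : ℝ}
    (ha : 1 ≤ a) (hab : a ≤ b) (hφ : ∀ ξ ∈ Set.Icc a b, x + 4 * ξ ^ 3 ≠ 0)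
    {B : ℝ → ℝ} {P : ℝ → ℝ} (hP : ∀ ξ ∈ Set.Icc a b, HasDerivAt P (B ξ) ξ)
    (hBc : ContinuousOn B (Set.Icc a b))
    (hB : ∀ ξ ∈ Set.Icc a b,
      ‖w‖ / |x + 4 * ξ ^ 3| + 12 * ξ ^ 3 / (x + 4 * ξ ^ 3) ^ 2 ≤ B ξ) :
    ‖∫ ξ in a..b, quarticIntegrand w x ξ‖ ≤
      b / |x + 4 * b ^ 3| + a / |x + 4 * a ^ 3| + (P b - P a) := by
  have hu : Set.uIcc a b = Set.Icc a b := Set.uIcc_of_le hab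
  have hpos : ∀ ξ ∈ Set.Icc a b, 0 < ξ := fun ξ hξ => by linarith [hξ.1]
  have hφc : ∀ ξ ∈ Set.Icc a b, ((x + 4 * ξ ^ 3 : ℝ) : ℂ) ≠ 0 := fun ξ hξ => by
    exact_mod_cast hφ ξ hξ
  set A : ℝ → ℂ := fun ξ => cexp (w * Real.log ξ) * ((x + 4 * ξ ^ 3 : ℝ) : ℂ)⁻¹ with hA
  set A' : ℝ → ℂ := fun ξ => cexp (w * Real.log ξ) * (w * ((ξ⁻¹ : ℝ) : ℂ)) *
      ((x + 4 * ξ ^ 3 : ℝ) : ℂ)⁻¹ +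
      cexp (w * Real.log ξ) * (-((12 * ξ ^ 2 : ℝ) : ℂ) / ((x + 4 * ξ ^ 3 : ℝ) : ℂ) ^ 2) with hA'
  set v : ℝ → ℂ := fun ξ => cexp (I * (x * ξ + ξ ^ 4)) with hv
  have hAd : ∀ ξ ∈ Set.uIcc a b, HasDerivAt A (A' ξ) ξ := by
    intro ξ hξ
    rw [hu] at hξ
    have h1 : HasDerivAt (fun ξ : ℝ => cexp (w * Real.log ξ))
        (cexp (w * Real.log ξ) * (w * ((ξ⁻¹ : ℝ) : ℂ))) ξ :=
      (((Real.hasDerivAt_log (hpos ξ hξ).ne').ofReal_comp).const_mul w).cexp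
    have h2 : HasDerivAt (fun ξ : ℝ => x + 4 * ξ ^ 3) (12 * ξ ^ 2) ξ := by
      exact (((hasDerivAt_pow 3 ξ).const_mul 4).const_add x).congr_deriv (by push_cast; ring)
    exact h1.mul (h2.ofReal_comp.inv (hφc ξ hξ))
  have hvd : ∀ ξ ∈ Set.uIcc a b, HasDerivAt v (v ξ * (I * ((x + 4 * ξ ^ 3 : ℝ) : ℂ))) ξ := by
    intro ξ _
    have h2 : HasDerivAt (fun ξ : ℝ => x * ξ + ξ ^ 4) (x + 4 * ξ ^ 3) ξ := by
      exact (((hasDerivAt_id' ξ).const_mul x).fun_add (hasDerivAt_pow 4 ξ)).congr_deriv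
        (by push_cast; ring)
    have := (h2.ofReal_comp.const_mul I).cexp
    simpa [hv] using this
  have hexpc : ContinuousOn (fun ξ : ℝ => cexp (w * Real.log ξ)) (Set.Icc a b) := by
    refine (continuousOn_const.mul ?_).cexp
    exact continuous_ofReal.comp_continuousOn
      (Real.continuousOn_log.mono fun ξ hξ => (hpos ξ hξ).ne')
  have hφcont : ContinuousOn (fun ξ : ℝ => ((x + 4 * ξ ^ 3 : ℝ) : ℂ)) (Set.Icc a b) := by fun_prop
  have hA'c : ContinuousOn A' (Set.Icc a b) := by
    refine ContinuousOn.add ?_ ?_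
    · refine (hexpc.mul (continuousOn_const.mul ?_)).mul (hφcont.inv₀ hφc)
      exact continuous_ofReal.comp_continuousOn
        (continuousOn_id.inv₀ fun ξ hξ => (hpos ξ hξ).ne')
    · refine hexpc.mul (ContinuousOn.div (by fun_prop) (hφcont.pow 2) ?_)
      exact fun ξ hξ => pow_ne_zero 2 (hφc ξ hξ)
  have hA'i : IntervalIntegrable A' volume a b := (hu ▸ hA'c).intervalIntegrable
  have hvi : IntervalIntegrable (fun ξ : ℝ => v ξ * (I * ((x + 4 * ξ ^ 3 : ℝ) : ℂ))) volume a b :=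
    Continuous.intervalIntegrable (by fun_prop) _ _
  have hparts := intervalIntegral.integral_mul_deriv_eq_deriv_mul hAd hvd hA'i hvi
  have hvn : ∀ ξ, ‖v ξ‖ = 1 := fun ξ => by simpa using norm_cexp_I_phase x 1 ξ
  have hlhs : ∫ ξ in a..b, A ξ * (v ξ * (I * ((x + 4 * ξ ^ 3 : ℝ) : ℂ))) =
      I * ∫ ξ in a..b, quarticIntegrand w x ξ := by
    rw [← intervalIntegral.integral_const_mul]
    refine intervalIntegral.integral_congr fun ξ hξ => ?_
    rw [hu] at hξ
    have := hφc ξ hξ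
    simp only [hA, hv, quarticIntegrand]
    field_simp
  have hrpow : ∀ ξ ∈ Set.Icc a b, ‖cexp (w * Real.log ξ)‖ ≤ ξ := by
    intro ξ hξ
    rw [norm_cexp_mul_log (hpos ξ hξ)]
    calc ξ ^ w.re ≤ ξ ^ (1 : ℝ) := Real.rpow_le_rpow_of_exponent_le (by linarith [hξ.1]) hw1
      _ = ξ := Real.rpow_one ξ
  have hAn : ∀ ξ ∈ Set.Icc a b, ‖A ξ‖ ≤ ξ / |x + 4 * ξ ^ 3| := by
    intro ξ hξ
    rw [hA, norm_mul, norm_inv, Complex.norm_real, Real.norm_eq_abs, ← div_eq_mul_inv]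
    gcongr
    exact hrpow ξ hξ
  have hA'n : ∀ ξ ∈ Set.Icc a b, ‖A' ξ * v ξ‖ ≤ B ξ := by
    intro ξ hξ
    rw [norm_mul, hvn, mul_one]
    refine le_trans ?_ (hB ξ hξ)
    refine (norm_add_le _ _).trans (add_le_add ?_ ?_)
    · rw [norm_mul, norm_mul, norm_mul, norm_inv, Complex.norm_real, Complex.norm_real,
        Real.norm_eq_abs, Real.norm_eq_abs, ← div_eq_mul_inv, abs_inv, abs_of_pos (hpos ξ hξ)]
      refine div_le_div_of_nonneg_right ?_ (abs_nonneg _)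
      calc _ ≤ ξ * (‖w‖ * ξ⁻¹) := mul_le_mul_of_nonneg_right (hrpow ξ hξ)
            (mul_nonneg (norm_nonneg _) (inv_nonneg.2 (hpos ξ hξ).le))
        _ = ‖w‖ := by have := (hpos ξ hξ).ne'; field_simp
    · rw [norm_mul, norm_div, norm_neg, norm_pow, Complex.norm_real, Complex.norm_real,
        Real.norm_eq_abs, Real.norm_eq_abs, sq_abs, abs_of_nonneg (by positivity), ← mul_div_assoc]
      refine div_le_div_of_nonneg_right ?_ (sq_nonneg _)
      calc _ ≤ ξ * (12 * ξ ^ 2) := mul_le_mul_of_nonneg_right (hrpow ξ hξ) (by positivity)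
        _ = _ := by ring
  have hBi : IntervalIntegrable B volume a b := (hu ▸ hBc).intervalIntegrable
  have hint : ‖∫ ξ in a..b, A' ξ * v ξ‖ ≤ P b - P a := by
    rw [← intervalIntegral.integral_eq_sub_of_hasDerivAt (hu ▸ hP) hBi]
    refine intervalIntegral.norm_integral_le_of_norm_le hab ?_ hBi
    exact Filter.Eventually.of_forall fun ξ hξ => hA'n ξ ⟨hξ.1.le, hξ.2⟩
  calc ‖∫ ξ in a..b, quarticIntegrand w x ξ‖
      = ‖I * ∫ ξ in a..b, quarticIntegrand w x ξ‖ := by simp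
    _ = ‖A b * v b - A a * v a - ∫ ξ in a..b, A' ξ * v ξ‖ := by rw [← hlhs, hparts]
    _ ≤ ‖A b * v b‖ + ‖A a * v a‖ + ‖∫ ξ in a..b, A' ξ * v ξ‖ :=
        (norm_sub_le _ _).trans (by gcongr; exact norm_sub_le _ _)
    _ ≤ _ := by
        have e : ∀ ξ, ‖A ξ * v ξ‖ = ‖A ξ‖ := fun ξ => by rw [norm_mul, hvn, mul_one]
        rw [e, e]
        exact add_le_add (add_le_add (hAn b ⟨hab, le_rfl⟩) (hAn a ⟨le_rfl, hab⟩)) hint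

theorem norm_integral_quarticIntegrand_right {w : ℂ} (hw1 : w.re ≤ 1)
    {x p a b : ℝ} (hp : 1 ≤ p) (hx : -4 * p ^ 3 ≤ x) (ha : p + 1 / p ≤ a) (hab : a ≤ b) :
    ‖∫ ξ in a..b, quarticIntegrand w x ξ‖ ≤ 2 * (1 + ‖w‖) := by
  have hp0 : 0 < p := by linarith
  have hip : 0 < 1 / p := by positivity
  have hlow : ∀ ξ ≥ a, 4 * (ξ - p) * ξ ^ 2 ≤ x + 4 * ξ ^ 3 := by
    intro ξ hξ
    have : p ≤ ξ := by linarith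
    have : 0 < ξ := by linarith
    nlinarith [mul_nonneg (sub_nonneg.2 ‹p ≤ ξ›) (by positivity : 0 ≤ p ^ 2 + p * ξ)]
  have hgap : ∀ ξ ≥ a, 1 / p ≤ ξ - p := fun ξ hξ => by linarith
  have hge : ∀ ξ ≥ a, p ≤ ξ := fun ξ hξ => by linarith
  have hpos : ∀ ξ ≥ a, 0 < x + 4 * ξ ^ 3 := fun ξ hξ => lt_of_lt_of_le
    (by have := hgap ξ hξ; have := hge ξ hξ; have : 0 < ξ - p := by linarith
        have : 0 < ξ := by linarith
        positivity) (hlow ξ hξ)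
  have hbd : ∀ ξ ≥ a, ξ / |x + 4 * ξ ^ 3| ≤ 1 / 4 := by
    intro ξ hξ
    rw [abs_of_pos (hpos ξ hξ), div_le_iff₀ (hpos ξ hξ)]
    have h1 := hgap ξ hξ
    have h2 := hge ξ hξ
    have h3 : 1 ≤ (ξ - p) * ξ := by
      calc 1 = 1 / p * p := by field_simp
        _ ≤ (ξ - p) * ξ := by gcongr
    have h4 := hlow ξ hξ
    nlinarith
  have h := norm_integral_quarticIntegrand_le hw1 (x := x)
    (B := fun ξ => ‖w‖ * p / (4 * ξ ^ 2) + 3 / 4 / (p * (ξ - p) ^ 2))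
    (P := fun ξ => -(‖w‖ * p / 4 * ξ⁻¹) - 3 / 4 / p * (ξ - p)⁻¹)
    (by linarith : 1 ≤ a) hab (fun ξ hξ => (hpos ξ hξ.1).ne') ?_ ?_ ?_
  · refine h.trans ?_
    have h1 := hbd a le_rfl
    have h2 := hbd b hab
    have h3 : ‖w‖ * p / 4 * a⁻¹ ≤ ‖w‖ / 4 := by
      have : p * a⁻¹ ≤ 1 := by
        rw [← div_eq_mul_inv]; exact div_le_one_of_le₀ (by linarith) (by linarith)
      nlinarith [norm_nonneg w]
    have h4 : 3 / 4 / p * (a - p)⁻¹ ≤ 3 / 4 := by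
      have : (a - p)⁻¹ ≤ p := by
        rw [inv_le_comm₀ (by linarith) hp0, ← one_div]; linarith
      calc 3 / 4 / p * (a - p)⁻¹ ≤ 3 / 4 / p * p := by gcongr
        _ = 3 / 4 := by field_simp
    have h5 : 0 ≤ ‖w‖ * p / 4 * b⁻¹ := by
      have : 0 < b := by linarith
      positivity
    have h6 : 0 ≤ 3 / 4 / p * (b - p)⁻¹ := by
      have : 0 < b - p := by linarith
      positivity
    linarith [norm_nonneg w]
  · intro ξ hξ
    have h0 : ξ ≠ 0 := by linarith [hξ.1]
    have h1 : ξ - p ≠ 0 := by linarith [hξ.1]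
    refine ((((hasDerivAt_inv h0).const_mul (‖w‖ * p / 4)).fun_neg).fun_sub
      ((((hasDerivAt_id' ξ).sub_const p).fun_inv h1).const_mul (3 / 4 / p))).congr_deriv ?_
    simp only [div_eq_mul_inv, mul_inv]
    ring
  · refine ContinuousOn.add (ContinuousOn.div (by fun_prop) (by fun_prop) ?_)
      (ContinuousOn.div (by fun_prop) (by fun_prop) ?_)
    · intro ξ hξ
      have : 0 < ξ := by linarith [hξ.1]
      positivity
    · intro ξ hξ
      have : 0 < ξ - p := by linarith [hξ.1]
      positivity
  · intro ξ hξ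
    have h1 := hgap ξ hξ.1
    have h2 := hge ξ hξ.1
    have h4 := hlow ξ hξ.1
    have h5 : 0 < ξ := by linarith
    have h6 : 0 < ξ - p := by linarith
    rw [abs_of_pos (hpos ξ hξ.1)]
    refine add_le_add ?_ ?_
    · calc ‖w‖ / (x + 4 * ξ ^ 3) ≤ ‖w‖ / (4 * (1 / p) * ξ ^ 2) := by
            gcongr
            refine le_trans ?_ h4
            gcongr
        _ = _ := by field_simp
    · calc 12 * ξ ^ 3 / (x + 4 * ξ ^ 3) ^ 2 ≤ 12 * ξ ^ 3 / (4 * (ξ - p) * ξ ^ 2) ^ 2 := by gcongr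
        _ = 3 / 4 / (ξ * (ξ - p) ^ 2) := by field_simp; norm_num
        _ ≤ _ := by gcongr

theorem norm_integral_quarticIntegrand_left {w : ℂ} (hw1 : w.re ≤ 1)
    {p a b : ℝ} (hp : 1 ≤ p) (ha : 1 ≤ a) (hab : a ≤ b) (hb : b ≤ p - 1 / p) :
    ‖∫ ξ in a..b, quarticIntegrand w (-4 * p ^ 3) ξ‖ ≤ 2 * (1 + ‖w‖) := by
  have hp0 : 0 < p := by linarith
  have hip : 0 < 1 / p := by positivity
  have hlow : ∀ ξ ∈ Set.Icc a b, 4 * (p - ξ) * p ^ 2 ≤ -(-4 * p ^ 3 + 4 * ξ ^ 3) := by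
    intro ξ hξ
    have : ξ ≤ p := by linarith [hξ.2]
    have : 0 < ξ := by linarith [hξ.1]
    nlinarith [mul_nonneg (sub_nonneg.2 ‹ξ ≤ p›) (by positivity : 0 ≤ ξ ^ 2 + p * ξ)]
  have hgap : ∀ ξ ∈ Set.Icc a b, 1 / p ≤ p - ξ := fun ξ hξ => by linarith [hξ.2]
  have hle : ∀ ξ ∈ Set.Icc a b, ξ ≤ p := fun ξ hξ => by linarith [hξ.2]
  have hpos : ∀ ξ ∈ Set.Icc a b, -4 * p ^ 3 + 4 * ξ ^ 3 < 0 := fun ξ hξ => by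
    have h1 := hlow ξ hξ
    have h2 : 0 < p - ξ := hip.trans_le (hgap ξ hξ)
    have : 0 < 4 * (p - ξ) * p ^ 2 := by positivity
    linarith
  have hbig : ∀ ξ ∈ Set.Icc a b, 4 * p ≤ |-4 * p ^ 3 + 4 * ξ ^ 3| := by
    intro ξ hξ
    rw [abs_of_neg (hpos ξ hξ)]
    refine le_trans ?_ (hlow ξ hξ)
    calc 4 * p = 4 * (1 / p) * p ^ 2 := by field_simp
      _ ≤ _ := by gcongr; exact hgap ξ hξ
  have hbd : ∀ ξ ∈ Set.Icc a b, ξ / |-4 * p ^ 3 + 4 * ξ ^ 3| ≤ 1 / 4 := by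
    intro ξ hξ
    rw [div_le_iff₀ (by linarith [hbig ξ hξ])]
    linarith [hbig ξ hξ, hle ξ hξ]
  have h := norm_integral_quarticIntegrand_le hw1 (x := -4 * p ^ 3)
    (B := fun ξ => ‖w‖ / (4 * p) + 3 / 4 / (p * (p - ξ) ^ 2))
    (P := fun ξ => ‖w‖ / (4 * p) * ξ + 3 / 4 / p * (p - ξ)⁻¹)
    ha hab (fun ξ hξ => (hpos ξ hξ).ne) ?_ ?_ ?_
  · refine h.trans ?_
    have h1 := hbd a ⟨le_rfl, hab⟩
    have h2 := hbd b ⟨hab, le_rfl⟩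
    have h3 : ‖w‖ / (4 * p) * b ≤ ‖w‖ / 4 := by
      calc ‖w‖ / (4 * p) * b ≤ ‖w‖ / (4 * p) * p := by gcongr; linarith
        _ = _ := by field_simp
    have h4 : 3 / 4 / p * (p - b)⁻¹ ≤ 3 / 4 := by
      have : (p - b)⁻¹ ≤ p := by
        rw [inv_le_comm₀ (by linarith) hp0, ← one_div]; linarith
      calc 3 / 4 / p * (p - b)⁻¹ ≤ 3 / 4 / p * p := by gcongr
        _ = 3 / 4 := by field_simp
    have h5 : 0 ≤ ‖w‖ / (4 * p) * a := by positivity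
    have h6 : 0 ≤ 3 / 4 / p * (p - a)⁻¹ := by
      have : 0 < p - a := by linarith
      positivity
    linarith [norm_nonneg w]
  · intro ξ hξ
    have h1 : p - ξ ≠ 0 := by linarith [hξ.2]
    refine (((hasDerivAt_id' ξ).const_mul (‖w‖ / (4 * p))).fun_add
      ((((hasDerivAt_id' ξ).const_sub p).fun_inv h1).const_mul (3 / 4 / p))).congr_deriv ?_
    simp only [div_eq_mul_inv, mul_inv]
    ring
  · refine ContinuousOn.add continuousOn_const (ContinuousOn.div (by fun_prop) (by fun_prop) ?_)
    intro ξ hξ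
    have : 0 < p - ξ := by linarith [hξ.2]
    positivity
  · intro ξ hξ
    have h1 := hgap ξ hξ
    have h4 := hlow ξ hξ
    have h5 : 0 < ξ := by linarith [hξ.1]
    have h6 : 0 < p - ξ := by linarith
    refine add_le_add ?_ ?_
    · gcongr
      exact hbig ξ hξ
    · calc 12 * ξ ^ 3 / (-4 * p ^ 3 + 4 * ξ ^ 3) ^ 2
          = 12 * ξ ^ 3 / (-(-4 * p ^ 3 + 4 * ξ ^ 3)) ^ 2 := by rw [neg_sq]
        _ ≤ 12 * p ^ 3 / (4 * (p - ξ) * p ^ 2) ^ 2 := by gcongr; exact hle ξ hξ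
        _ = _ := by field_simp; norm_num

theorem measurable_quarticIntegrand (w : ℂ) (x : ℝ) : Measurable (quarticIntegrand w x) := by
  unfold quarticIntegrand
  fun_prop

theorem intervalIntegrable_quarticIntegrand {w : ℂ} (hw0 : 0 ≤ w.re) (x : ℝ) {a b : ℝ}
    (ha : 0 ≤ a) (hb : 0 ≤ b) : IntervalIntegrable (quarticIntegrand w x) volume a b := by
  have hc : IntervalIntegrable (fun ξ : ℝ => ξ ^ w.re) volume a b :=
    intervalIntegral.intervalIntegrable_rpow (Or.inl hw0)
  refine hc.mono_fun (measurable_quarticIntegrand w x).aestronglyMeasurable ?_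
  refine (ae_restrict_iff' measurableSet_uIoc).2 (Filter.Eventually.of_forall fun ξ hξ => ?_)
  have h0 : 0 < ξ := (le_min ha hb).trans_lt hξ.1
  beta_reduce
  rw [norm_quarticIntegrand h0]
  exact le_abs_self _

theorem norm_integral_quarticIntegrand_trivial {w : ℂ} (hw0 : 0 ≤ w.re) (hw1 : w.re ≤ 1)
    (x : ℝ) {a b M : ℝ} (ha : 0 ≤ a) (hab : a ≤ b) (hM : 1 ≤ M) (hbM : b ≤ M) :
    ‖∫ ξ in a..b, quarticIntegrand w x ξ‖ ≤ M * (b - a) := by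
  have := intervalIntegral.norm_integral_le_of_norm_le_const (a := a) (b := b)
    (f := quarticIntegrand w x) (C := M) fun ξ hξ => by
      rw [Set.uIoc_of_le hab] at hξ
      have h0 : 0 < ξ := ha.trans_lt hξ.1
      rw [norm_quarticIntegrand h0]
      calc ξ ^ w.re ≤ M ^ w.re := Real.rpow_le_rpow h0.le (hξ.2.trans hbM) hw0
        _ ≤ M ^ (1 : ℝ) := Real.rpow_le_rpow_of_exponent_le hM hw1
        _ = M := Real.rpow_one M
  rwa [abs_of_nonneg (sub_nonneg.2 hab)] at this

theorem norm_integral_quarticIntegrand_Icc {w : ℂ} (hw0 : 0 ≤ w.re) (hw1 : w.re ≤ 1)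
    {x p R : ℝ} (hp : 1 ≤ p) (hx : -4 * p ^ 3 ≤ x) (hxp : 1 < p → x = -4 * p ^ 3) (hR : 1 ≤ R) :
    ‖∫ ξ in (1 : ℝ)..R, quarticIntegrand w x ξ‖ ≤ 4 * (1 + ‖w‖) + 4 := by
  have hp0 : 0 < p := by linarith
  have hip : 0 < 1 / p := by positivity
  have hip1 : 1 / p ≤ 1 := by rw [div_le_one hp0]; exact hp
  have hw := norm_nonneg w
  set a := max 1 (min (p - 1 / p) R) with ha
  set b := max a (min (p + 1 / p) R) with hb
  have ha1 : 1 ≤ a := le_max_left _ _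
  have hab : a ≤ b := le_max_left _ _
  have haR : a ≤ R := max_le hR (min_le_right _ _)
  have hbR : b ≤ R := max_le haR (min_le_right _ _)
  have hint : ∀ c d : ℝ, 1 ≤ c → 1 ≤ d → IntervalIntegrable (quarticIntegrand w x) volume c d :=
    fun c d hc hd => intervalIntegrable_quarticIntegrand hw0 x (by linarith) (by linarith)
  have h1 : ‖∫ ξ in (1 : ℝ)..a, quarticIntegrand w x ξ‖ ≤ 2 * (1 + ‖w‖) := by
    rcases le_or_gt (min (p - 1 / p) R) 1 with h | h
    · rw [ha, max_eq_left h]; simp; linarith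
    · have hap : a ≤ p - 1 / p := by rw [ha, max_eq_right h.le]; exact min_le_left _ _
      rw [hxp (by linarith)]
      exact norm_integral_quarticIntegrand_left hw1 hp le_rfl ha1 hap
  have h3 : ‖∫ ξ in b..R, quarticIntegrand w x ξ‖ ≤ 2 * (1 + ‖w‖) := by
    rcases le_or_gt (p + 1 / p) R with h | h
    · refine norm_integral_quarticIntegrand_right hw1 hp hx ?_ hbR
      rw [hb, min_eq_left h]; exact le_max_right _ _
    · have : b = R := le_antisymm hbR (by rw [hb, min_eq_right h.le]; exact le_max_right _ _)
      rw [this]; simp; linarith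
  have h2 : ‖∫ ξ in a..b, quarticIntegrand w x ξ‖ ≤ 4 := by
    have hbp : b ≤ p + 1 / p :=
      max_le (max_le (by linarith) ((min_le_left _ _).trans (by linarith))) (min_le_left _ _)
    have hba : b - a ≤ 2 / p := by
      rcases le_or_gt (p - 1 / p) R with h | h
      · have : p - 1 / p ≤ a := by rw [ha, min_eq_left h]; exact le_max_right _ _
        calc b - a ≤ (p + 1 / p) - (p - 1 / p) := by linarith
          _ = 2 / p := by ring
      · have : R ≤ a := by rw [ha, min_eq_right h.le]; exact le_max_right _ _
        have : 0 < 2 / p := by positivity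
        linarith
    calc _ ≤ (2 * p) * (b - a) := norm_integral_quarticIntegrand_trivial hw0 hw1 x
            (by linarith) hab (by linarith) (by linarith)
      _ ≤ (2 * p) * (2 / p) := by gcongr
      _ = 4 := by field_simp; norm_num
  have e1 := intervalIntegral.integral_add_adjacent_intervals (hint 1 a le_rfl ha1)
    (hint a b ha1 (ha1.trans hab))
  have e2 := intervalIntegral.integral_add_adjacent_intervals (hint 1 b le_rfl (ha1.trans hab))
    (hint b R (ha1.trans hab) hR)
  rw [← e2, ← e1]
  calc _ ≤ _ := norm_add₃_le
    _ ≤ _ := by linarith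

/-- Uniform bound for the model oscillatory integral. -/
theorem norm_integral_quarticIntegrand_zero_le {w : ℂ} (hw0 : 0 ≤ w.re) (hw1 : w.re ≤ 1)
    (x : ℝ) {R : ℝ} (hR : 0 ≤ R) :
    ‖∫ ξ in (0 : ℝ)..R, quarticIntegrand w x ξ‖ ≤ 9 * (1 + ‖w‖) := by
  have hw := norm_nonneg w
  rcases le_or_gt R 1 with h | h
  · have := norm_integral_quarticIntegrand_trivial hw0 hw1 x le_rfl hR le_rfl h
    linarith
  obtain ⟨p, hp, hxp, hx⟩ : ∃ p : ℝ, 1 ≤ p ∧ -4 * p ^ 3 ≤ x ∧ (1 < p → x = -4 * p ^ 3) := by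
    rcases le_or_gt (-4) x with h4 | h4
    · exact ⟨1, le_rfl, by linarith, fun h => absurd h (lt_irrefl _)⟩
    · have hc : ((-x / 4) ^ (1 / 3 : ℝ)) ^ 3 = -x / 4 := by
        rw [← Real.rpow_natCast, ← Real.rpow_mul (by linarith)]; norm_num
      refine ⟨(-x / 4) ^ (1 / 3 : ℝ), Real.one_le_rpow (by linarith) (by norm_num), ?_, ?_⟩
      · rw [hc]; linarith
      · intro _; rw [hc]; ring
  have e := intervalIntegral.integral_add_adjacent_intervals
    (intervalIntegrable_quarticIntegrand hw0 x le_rfl zero_le_one)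
    (intervalIntegrable_quarticIntegrand hw0 x zero_le_one hR)
  rw [← e]
  have h1 := norm_integral_quarticIntegrand_trivial hw0 hw1 x le_rfl zero_le_one le_rfl le_rfl
  have h2 := norm_integral_quarticIntegrand_Icc hw0 hw1 hp hxp hx h.le
  calc _ ≤ _ := norm_add_le _ _
    _ ≤ _ := by linarith

/-- The oscillatory integrand `|ξ| ^ w * e^{i (x ξ + t ξ ^ 4)}`; recall `Real.log ξ = log |ξ|`. -/
noncomputable def bihamIntegrand (w : ℂ) (t x ξ : ℝ) : ℂ :=
  cexp (w * Real.log ξ) * cexp (I * (x * ξ + t * ξ ^ 4))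

theorem bihamIntegrand_neg (w : ℂ) (t x ξ : ℝ) :
    bihamIntegrand w t x (-ξ) = bihamIntegrand w t (-x) ξ := by
  simp only [bihamIntegrand, Real.log_neg_eq_log, ofReal_neg]
  congr 2; ring

theorem conj_bihamIntegrand (w : ℂ) (t x ξ : ℝ) :
    (starRingEnd ℂ) (bihamIntegrand w t x ξ) =
      bihamIntegrand ((starRingEnd ℂ) w) (-t) (-x) ξ := by
  simp only [bihamIntegrand, map_mul, ← exp_conj, conj_I, conj_ofReal, map_add, map_pow,
    ofReal_neg]
  congr 2; ring

theorem norm_bihamIntegrand {w : ℂ} {t x ξ : ℝ} (hξ : ξ ≠ 0) :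
    ‖bihamIntegrand w t x ξ‖ = |ξ| ^ w.re := by
  rw [bihamIntegrand, norm_mul, norm_cexp_I_phase, mul_one, ← Real.log_abs,
    norm_cexp_mul_log (abs_pos.2 hξ)]

theorem measurable_bihamIntegrand (w : ℂ) (t x : ℝ) : Measurable (bihamIntegrand w t x) := by
  unfold bihamIntegrand
  fun_prop

theorem intervalIntegrable_bihamIntegrand {w : ℂ} (hw0 : 0 ≤ w.re) (t x a b : ℝ) :
    IntervalIntegrable (bihamIntegrand w t x) volume a b := by
  have hc : IntervalIntegrable (fun ξ : ℝ => |ξ| ^ w.re) volume a b :=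
    Continuous.intervalIntegrable
      (continuous_abs.rpow_const fun _ => Or.inr hw0) _ _
  refine hc.mono_fun (measurable_bihamIntegrand w t x).aestronglyMeasurable ?_
  have : ∀ᵐ ξ : ℝ, ξ ≠ 0 := by simp [ae_iff]
  filter_upwards [ae_restrict_of_ae this] with ξ hξ
  rw [norm_bihamIntegrand hξ]
  exact le_abs_self _

theorem norm_integral_bihamIntegrand_of_pos {w : ℂ} (hw0 : 0 ≤ w.re) (hw1 : w.re ≤ 1)
    {t : ℝ} (ht : 0 < t) (x : ℝ) {R : ℝ} (hR : 0 ≤ R) :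
    ‖∫ ξ in (0 : ℝ)..R, bihamIntegrand w t x ξ‖ ≤
      9 * (1 + ‖w‖) * t ^ (-((1 + w.re) / 4)) := by
  set s : ℝ := t ^ (-(1 / 4) : ℝ) with hs
  have hs0 : 0 < s := Real.rpow_pos_of_pos ht _
  have hts : t * s ^ 4 = 1 := by
    rw [hs, ← Real.rpow_natCast, ← Real.rpow_mul ht.le]
    norm_num
    rw [Real.rpow_neg_one, mul_inv_cancel₀ ht.ne']
  have h := intervalIntegral.smul_integral_comp_mul_left (bihamIntegrand w t x) s
    (a := 0) (b := R / s)
  rw [mul_zero, mul_div_cancel₀ _ hs0.ne'] at h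
  have hcongr : ∫ η in (0 : ℝ)..R / s, bihamIntegrand w t x (s * η) =
      cexp (w * Real.log s) * ∫ η in (0 : ℝ)..R / s, quarticIntegrand w (x * s) η := by
    rw [← intervalIntegral.integral_const_mul]
    refine intervalIntegral.integral_congr_ae (Filter.Eventually.of_forall fun η hη => ?_)
    rw [Set.uIoc_of_le (by positivity)] at hη
    simp only [bihamIntegrand, quarticIntegrand, Real.log_mul hs0.ne' hη.1.ne']
    simp only [← Complex.exp_add]
    have hts' : (t : ℂ) * s ^ 4 = 1 := by exact_mod_cast hts
    congr 1
    push_cast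
    linear_combination (I * (η : ℂ) ^ 4) * hts'
  rw [← h, hcongr, norm_smul, norm_mul, norm_cexp_mul_log hs0, Real.norm_of_nonneg hs0.le]
  have h9 := norm_integral_quarticIntegrand_zero_le hw0 hw1 (x * s) (R := R / s) (by positivity)
  have hsp : s * s ^ w.re = t ^ (-((1 + w.re) / 4)) := by
    nth_rw 1 [← Real.rpow_one s]
    rw [← Real.rpow_add hs0, hs, ← Real.rpow_mul ht.le]
    congr 1; ring
  rw [← mul_assoc, hsp, mul_comm]
  gcongr

theorem norm_integral_bihamIntegrand_half {w : ℂ} (hw0 : 0 ≤ w.re) (hw1 : w.re ≤ 1)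
    {t : ℝ} (ht : t ≠ 0) (x : ℝ) {R : ℝ} (hR : 0 ≤ R) :
    ‖∫ ξ in (0 : ℝ)..R, bihamIntegrand w t x ξ‖ ≤
      9 * (1 + ‖w‖) * |t| ^ (-((1 + w.re) / 4)) := by
  rcases lt_or_gt_of_ne ht with h | h
  · have := norm_integral_bihamIntegrand_of_pos (w := (starRingEnd ℂ) w) (by simpa) (by simpa)
      (neg_pos.2 h) (-x) hR
    rw [abs_of_neg h]
    simp only [← conj_bihamIntegrand, RCLike.norm_conj, conj_re] at this
    rw [intervalIntegral.integral_of_le hR, integral_conj (𝕜 := ℂ), RCLike.norm_conj,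
      ← intervalIntegral.integral_of_le hR] at this
    exact this
  · rw [abs_of_pos h]
    exact norm_integral_bihamIntegrand_of_pos hw0 hw1 h x hR

/-- The dispersive bound for the truncated kernel of the biharmonic group. -/
theorem norm_integral_bihamIntegrand_le {w : ℂ} (hw0 : 0 ≤ w.re) (hw1 : w.re ≤ 1)
    {t : ℝ} (ht : t ≠ 0) (x : ℝ) {R : ℝ} (hR : 0 ≤ R) :
    ‖∫ ξ in Set.Icc (-R) R, bihamIntegrand w t x ξ‖ ≤
      18 * (1 + ‖w‖) * |t| ^ (-((1 + w.re) / 4)) := by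
  rw [integral_Icc_eq_integral_Ioc, ← intervalIntegral.integral_of_le (by linarith),
    ← intervalIntegral.integral_add_adjacent_intervals
      (intervalIntegrable_bihamIntegrand hw0 t x (-R) 0)
      (intervalIntegrable_bihamIntegrand hw0 t x 0 R)]
  have e : ∫ ξ in (-R)..0, bihamIntegrand w t x ξ = ∫ ξ in (0 : ℝ)..R, bihamIntegrand w t (-x) ξ := by
    have := intervalIntegral.integral_comp_neg (a := 0) (b := R) (bihamIntegrand w t x)
    rw [neg_zero] at this
    rw [← this]
    simp only [bihamIntegrand_neg]
  rw [e]
  have h1 := norm_integral_bihamIntegrand_half hw0 hw1 ht x hR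
  have h2 := norm_integral_bihamIntegrand_half hw0 hw1 ht (-x) hR
  calc _ ≤ _ := norm_add_le _ _
    _ ≤ _ := by linarith

theorem exp_mul_le_one_add_exp {s L : ℝ} (h0 : 0 ≤ s) (h1 : s ≤ 1) :
    Real.exp (s * L) ≤ 1 + Real.exp L := by
  rcases le_total 0 L with h | h
  · have : Real.exp (s * L) ≤ Real.exp L := Real.exp_le_exp.2 (by nlinarith)
    linarith
  · have : Real.exp (s * L) ≤ 1 := Real.exp_le_one_iff.2 (mul_nonpos_of_nonneg_of_nonpos h0 h)
    linarith [Real.exp_pos L]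

theorem norm_mul_cexp_le {Ω : Type*} {A : Ω → ℂ} {L : Ω → ℝ} (z : ℂ) (h0 : 0 ≤ z.re) (h1 : z.re ≤ 1) (ω : Ω) :
    ‖A ω * cexp (z * L ω)‖ ≤ ‖A ω‖ * (1 + Real.exp (L ω)) := by
  rw [norm_mul, Complex.norm_exp, re_mul_ofReal]
  gcongr
  exact exp_mul_le_one_add_exp h0 h1

section StripIntegral

variable {Ω : Type*} [MeasurableSpace Ω] {μ : Measure Ω} {A : Ω → ℂ} {L : Ω → ℝ}

theorem integrable_norm_mul_one_add_exp (hA0 : Integrable A μ)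
    (hA1 : Integrable (fun ω => ‖A ω‖ * Real.exp (L ω)) μ) :
    Integrable (fun ω => ‖A ω‖ * (1 + Real.exp (L ω))) μ := by
  simp only [mul_add, mul_one]
  exact hA0.norm.add hA1

theorem aestronglyMeasurable_mul_cexp (hA : AEStronglyMeasurable A μ) (hL : Measurable L) (z : ℂ) :
    AEStronglyMeasurable (fun ω => A ω * cexp (z * L ω)) μ :=
  hA.mul (by fun_prop : Measurable fun ω => cexp (z * L ω)).aestronglyMeasurable

theorem norm_integral_mul_cexp_le (hA0 : Integrable A μ)
    (hA1 : Integrable (fun ω => ‖A ω‖ * Real.exp (L ω)) μ) {z : ℂ} (h0 : 0 ≤ z.re)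
    (h1 : z.re ≤ 1) :
    ‖∫ ω, A ω * cexp (z * L ω) ∂μ‖ ≤ ∫ ω, ‖A ω‖ * (1 + Real.exp (L ω)) ∂μ :=
  norm_integral_le_of_norm_le (integrable_norm_mul_one_add_exp hA0 hA1)
    (Filter.Eventually.of_forall fun ω => norm_mul_cexp_le z h0 h1 ω)

theorem diffContOnCl_integral_mul_cexp (hL : Measurable L) (hA0 : Integrable A μ)
    (hA1 : Integrable (fun ω => ‖A ω‖ * Real.exp (L ω)) μ) :
    DiffContOnCl ℂ (fun z : ℂ => ∫ ω, A ω * cexp (z * L ω) ∂μ)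
      (HadamardThreeLines.verticalStrip 0 1) := by
  have hint := integrable_norm_mul_one_add_exp hA0 hA1
  have hm := aestronglyMeasurable_mul_cexp hA0.aestronglyMeasurable hL
  refine ⟨fun z hz => ?_, ?_⟩
  · obtain ⟨hz0, hz1⟩ : 0 < z.re ∧ z.re < 1 := hz
    obtain ⟨δ, hδ, hδ0, hδ1⟩ : ∃ δ > 0, 2 * δ ≤ z.re ∧ z.re + 2 * δ ≤ 1 :=
      ⟨min z.re (1 - z.re) / 2, by have := lt_min hz0 (sub_pos.2 hz1); positivity,
        by linarith [min_le_left z.re (1 - z.re)], by linarith [min_le_right z.re (1 - z.re)]⟩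
    have hbound : ∀ ω, ∀ w ∈ Metric.ball z δ, ‖A ω * (cexp (w * L ω) * L ω)‖ ≤
        2 * δ⁻¹ * (‖A ω‖ * (1 + Real.exp (L ω))) := by
      intro ω w hw
      have hre : |w.re - z.re| < δ := by
        rw [← sub_re]
        exact (abs_re_le_norm _).trans_lt (by simpa [dist_eq_norm] using hw)
      obtain ⟨hr1, hr2⟩ := abs_lt.1 hre
      have e1 : Real.exp ((w.re + δ) * L ω) ≤ 1 + Real.exp (L ω) :=
        exp_mul_le_one_add_exp (by linarith) (by linarith)
      have e2 : Real.exp ((w.re - δ) * L ω) ≤ 1 + Real.exp (L ω) :=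
        exp_mul_le_one_add_exp (by linarith) (by linarith)
      have e3 : δ * |L ω| * Real.exp (w.re * L ω) ≤ 2 * (1 + Real.exp (L ω)) := by
        have h4 : δ * |L ω| ≤ Real.exp (δ * |L ω|) := by
          linarith [Real.add_one_le_exp (δ * |L ω|)]
        calc δ * |L ω| * Real.exp (w.re * L ω)
            ≤ Real.exp (δ * |L ω|) * Real.exp (w.re * L ω) := by gcongr
          _ = Real.exp (δ * |L ω| + w.re * L ω) := (Real.exp_add _ _).symm
          _ ≤ 2 * (1 + Real.exp (L ω)) := by
            rcases abs_cases (L ω) with ⟨h, _⟩ | ⟨h, _⟩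
            · rw [h, show δ * L ω + w.re * L ω = (w.re + δ) * L ω by ring]
              linarith [Real.exp_pos (L ω)]
            · rw [h, show δ * -L ω + w.re * L ω = (w.re - δ) * L ω by ring]
              linarith [Real.exp_pos (L ω)]
      rw [norm_mul, norm_mul, Complex.norm_exp, re_mul_ofReal, norm_real, Real.norm_eq_abs]
      calc ‖A ω‖ * (Real.exp (w.re * L ω) * |L ω|)
          = δ⁻¹ * ‖A ω‖ * (δ * |L ω| * Real.exp (w.re * L ω)) := by field_simp
        _ ≤ δ⁻¹ * ‖A ω‖ * (2 * (1 + Real.exp (L ω))) := by gcongr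
        _ = _ := by ring
    have := hasDerivAt_integral_of_dominated_loc_of_deriv_le (𝕜 := ℂ) (μ := μ) (x₀ := z)
      (F := fun z ω => A ω * cexp (z * L ω))
      (F' := fun z ω => A ω * (cexp (z * L ω) * L ω))
      (bound := fun ω => 2 * δ⁻¹ * (‖A ω‖ * (1 + Real.exp (L ω))))
      (Metric.ball_mem_nhds z hδ) (Filter.Eventually.of_forall hm)
      (hint.mono' (hm z) (Filter.Eventually.of_forall (norm_mul_cexp_le z hz0.le hz1.le)))
      (hA0.aestronglyMeasurable.mul
        (by fun_prop : Measurable fun ω => cexp (z * L ω) * L ω).aestronglyMeasurable)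
      (Filter.Eventually.of_forall hbound) (hint.const_mul _)
      (Filter.Eventually.of_forall fun ω w _ => by
        have := (((hasDerivAt_id' w).mul_const (L ω : ℂ)).cexp).const_mul (A ω)
        simpa using this)
    exact this.2.differentiableAt.differentiableWithinAt
  · have hcl : closure (HadamardThreeLines.verticalStrip 0 1) ⊆
        {z : ℂ | 0 ≤ z.re ∧ z.re ≤ 1} := by
      refine closure_minimal (fun z hz => ⟨hz.1.le, hz.2.le⟩) ?_
      exact (isClosed_le continuous_const continuous_re).inter
        (isClosed_le continuous_re continuous_const)
    refine ContinuousOn.mono ?_ hcl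
    refine continuousOn_of_dominated (fun z _ => hm z)
      (fun z hz => Filter.Eventually.of_forall (norm_mul_cexp_le z hz.1 hz.2)) hint ?_
    exact Filter.Eventually.of_forall fun ω => by fun_prop

end StripIntegral

/-- Three lines theorem allowing linear growth on the right boundary line. -/
theorem norm_le_of_three_lines_of_linear_growth {Φ : ℂ → ℂ} {B M₀ M₁ θ : ℝ}
    (hΦ : DiffContOnCl ℂ Φ (HadamardThreeLines.verticalStrip 0 1))
    (hB : ∀ z : ℂ, 0 ≤ z.re → z.re ≤ 1 → ‖Φ z‖ ≤ B) (hM₁ : 0 ≤ M₁)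
    (h₀ : ∀ z : ℂ, z.re = 0 → ‖Φ z‖ ≤ M₀)
    (h₁ : ∀ z : ℂ, z.re = 1 → ‖Φ z‖ ≤ M₁ * (2 + |z.im|)) (hθ₀ : 0 ≤ θ) (hθ₁ : θ ≤ 1) :
    ‖Φ θ‖ ≤ 9 * (M₀ ^ (1 - θ) * M₁ ^ θ) := by
  have hM₀ : 0 ≤ M₀ := (norm_nonneg _).trans (h₀ 0 rfl)
  have hB0 : 0 ≤ B := (norm_nonneg _).trans (hB 0 le_rfl zero_le_one)
  have hn : ∀ z : ℂ, ‖cexp (z ^ 2)‖ = Real.exp (z.re ^ 2 - z.im ^ 2) := fun z => by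
    rw [Complex.norm_exp, pow_two, mul_re]; ring_nf
  have key := HadamardThreeLines.norm_le_interp_of_mem_verticalClosedStrip₀₁'
    (fun z => Φ z * cexp (z ^ 2)) (z := (θ : ℂ)) (a := M₀) (b := 9 * M₁)
    ⟨by simpa, by simpa⟩ ⟨hΦ.1.mul (by fun_prop), hΦ.2.mul (by fun_prop)⟩ ?_ ?_ ?_
  · have h1 : ‖Φ θ‖ ≤ ‖Φ θ * cexp ((θ : ℂ) ^ 2)‖ := by
      rw [norm_mul, hn]
      refine le_mul_of_one_le_right (norm_nonneg _) (Real.one_le_exp ?_)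
      simp [sq_nonneg]
    refine (h1.trans key).trans ?_
    rw [ofReal_re, Real.mul_rpow (by norm_num) hM₁]
    have : (9 : ℝ) ^ θ ≤ 9 := by
      calc (9 : ℝ) ^ θ ≤ 9 ^ (1 : ℝ) := Real.rpow_le_rpow_of_exponent_le (by norm_num) hθ₁
        _ = 9 := Real.rpow_one 9
    calc _ = 9 ^ θ * (M₀ ^ (1 - θ) * M₁ ^ θ) := by ring
      _ ≤ _ := by gcongr
  · refine ⟨B * Real.exp 1, ?_⟩
    rintro _ ⟨z, hz, rfl⟩
    obtain ⟨hz0, hz1⟩ : 0 ≤ z.re ∧ z.re ≤ 1 := hz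
    simp only [Function.comp_apply, norm_mul, hn]
    gcongr
    · exact hB z hz0 hz1
    · nlinarith [sq_nonneg z.im]
  · intro z hz
    have hz : z.re = 0 := hz
    rw [norm_mul, hn, hz]
    calc _ ≤ M₀ * 1 := by
          gcongr
          · exact h₀ z hz
          · exact Real.exp_le_one_iff.2 (by nlinarith [sq_nonneg z.im])
      _ = M₀ := mul_one _
  · intro z hz
    have hz : z.re = 1 := hz
    rw [norm_mul, hn, hz]
    have h2 : (2 + |z.im|) * Real.exp (1 ^ 2 - z.im ^ 2) ≤ 9 := by
      rw [Real.exp_sub, one_pow, ← mul_div_assoc, div_le_iff₀ (Real.exp_pos _)]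
      have h3 := Real.add_one_le_exp (z.im ^ 2)
      have h4 : Real.exp 1 < 3 := by linarith [Real.exp_one_lt_d9]
      have h5 : 2 + |z.im| ≤ 3 * Real.exp (z.im ^ 2) := by
        rw [← sq_abs] at *
        nlinarith [abs_nonneg z.im, sq_nonneg (|z.im| - 1)]
      calc _ ≤ 3 * Real.exp (z.im ^ 2) * 3 := by gcongr
        _ = _ := by ring
    calc _ ≤ M₁ * (2 + |z.im|) * Real.exp (1 ^ 2 - z.im ^ 2) := by gcongr; exact h₁ z hz
      _ = M₁ * ((2 + |z.im|) * Real.exp (1 ^ 2 - z.im ^ 2)) := by ring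
      _ ≤ M₁ * 9 := by gcongr
      _ = _ := mul_comm _ _

/-- The truncated biharmonic evolution tested against a function. -/
noncomputable def bihamForm (w : ℂ) (t R : ℝ) (f g : ℝ → ℂ) : ℂ :=
  ∫ ω : ℝ × ℝ × ℝ, bihamIntegrand w t (ω.2.2 - ω.2.1) ω.1 * (f ω.2.1 * g ω.2.2)
    ∂((volume.restrict (Set.Icc (-R) R)).prod (volume.prod volume))

theorem measurable_bihamIntegrand_prod (w : ℂ) (t : ℝ) :
    Measurable fun ω : ℝ × ℝ × ℝ => bihamIntegrand w t (ω.2.2 - ω.2.1) ω.1 := by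
  unfold bihamIntegrand
  fun_prop

theorem norm_bihamIntegrand_le {w : ℂ} (hw0 : 0 ≤ w.re) (hw1 : w.re ≤ 1) {t x ξ R : ℝ}
    (hξ : ξ ∈ Set.Icc (-R) R) : ‖bihamIntegrand w t x ξ‖ ≤ 1 + R := by
  have hR : |ξ| ≤ R := abs_le.2 hξ
  have hR0 : 0 ≤ R := (abs_nonneg ξ).trans hR
  rcases eq_or_ne ξ 0 with rfl | h
  · rw [bihamIntegrand, norm_mul, norm_cexp_I_phase]
    simp [hR0]
  · rw [norm_bihamIntegrand h]
    calc |ξ| ^ w.re ≤ (1 + R) ^ w.re := Real.rpow_le_rpow (abs_nonneg _) (by linarith) hw0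
      _ ≤ (1 + R) ^ (1 : ℝ) := Real.rpow_le_rpow_of_exponent_le (by linarith) hw1
      _ = 1 + R := Real.rpow_one _

section Form

variable {w : ℂ} {t R : ℝ} {f g : ℝ → ℂ}

theorem ae_fst_mem_Icc {β : Type*} [MeasurableSpace β] (ν : Measure β) (R : ℝ) :
    ∀ᵐ ω ∂((volume.restrict (Set.Icc (-R) R)).prod ν), ω.1 ∈ Set.Icc (-R) R :=
  Measure.quasiMeasurePreserving_fst.ae (ae_restrict_mem measurableSet_Icc)

theorem integrable_mul_mul_of_bounded (hf : Integrable f) (hg : Integrable g)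
    {k : ℝ × ℝ × ℝ → ℂ} (hk : Measurable k) {M : ℝ}
    (hM : ∀ ω : ℝ × ℝ × ℝ, ω.1 ∈ Set.Icc (-R) R → ‖k ω‖ ≤ M) :
    Integrable (fun ω : ℝ × ℝ × ℝ => k ω * (f ω.2.1 * g ω.2.2))
      ((volume.restrict (Set.Icc (-R) R)).prod (volume.prod volume)) := by
  have h1 : Integrable (fun ω : ℝ × ℝ × ℝ => f ω.2.1 * g ω.2.2)
      ((volume.restrict (Set.Icc (-R) R)).prod (volume.prod volume)) :=
    (hf.mul_prod hg).comp_snd _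
  refine h1.bdd_mul hk.aestronglyMeasurable (c := M) ?_
  filter_upwards [ae_fst_mem_Icc _ R] with ω hω
  exact hM ω hω

theorem integrable_bihamForm (hw0 : 0 ≤ w.re) (hw1 : w.re ≤ 1) (hf : Integrable f)
    (hg : Integrable g) :
    Integrable (fun ω : ℝ × ℝ × ℝ => bihamIntegrand w t (ω.2.2 - ω.2.1) ω.1 *
      (f ω.2.1 * g ω.2.2)) ((volume.restrict (Set.Icc (-R) R)).prod (volume.prod volume)) :=
  integrable_mul_mul_of_bounded hf hg (measurable_bihamIntegrand_prod w t)
    fun _ hω => norm_bihamIntegrand_le hw0 hw1 hω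

theorem bihamIntegrand_sub (w : ℂ) (t x y ξ : ℝ) : bihamIntegrand w t (y - x) ξ =
    bihamIntegrand w t y ξ * cexp (-(I * x * ξ)) := by
  simp only [bihamIntegrand, ← Complex.exp_add]
  congr 1; push_cast; ring

theorem bihamIntegrand_eq_zero_mul (w : ℂ) (t y ξ : ℝ) : bihamIntegrand w t y ξ =
    bihamIntegrand w t 0 ξ * cexp (-(I * y * (-ξ : ℝ))) := by
  simp only [bihamIntegrand, ← Complex.exp_add]
  congr 1; push_cast; ring

theorem bihamForm_eq_integral_kernel (hw0 : 0 ≤ w.re) (hw1 : w.re ≤ 1) (hf : Integrable f)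
    (hg : Integrable g) : bihamForm w t R f g =
      ∫ p : ℝ × ℝ, (∫ ξ in Set.Icc (-R) R, bihamIntegrand w t (p.2 - p.1) ξ) * (f p.1 * g p.2)
        ∂(volume.prod volume) := by
  rw [bihamForm, integral_prod_symm _ (integrable_bihamForm hw0 hw1 hf hg)]
  simp only [integral_mul_const]

theorem bihamForm_eq_integral_fourierInt (hw0 : 0 ≤ w.re) (hw1 : w.re ≤ 1) (hf : Integrable f)
    (hg : Integrable g) : bihamForm w t R f g =
      ∫ ξ in Set.Icc (-R) R, bihamIntegrand w t 0 ξ * (fourierInt f ξ * fourierInt g (-ξ)) := by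
  rw [bihamForm, integral_prod _ (integrable_bihamForm hw0 hw1 hf hg)]
  congr 1 with ξ
  have : ∀ p : ℝ × ℝ, bihamIntegrand w t (p.2 - p.1) ξ * (f p.1 * g p.2) =
      bihamIntegrand w t 0 ξ * ((cexp (-(I * p.1 * ξ)) * f p.1) *
        (cexp (-(I * p.2 * (-ξ : ℝ))) * g p.2)) := fun p => by
    rw [bihamIntegrand_sub, bihamIntegrand_eq_zero_mul]; ring
  simp only [this]
  rw [integral_const_mul, integral_prod_mul (μ := volume) (ν := volume)
    (fun x : ℝ => cexp (-(I * x * ξ)) * f x) (fun y : ℝ => cexp (-(I * y * (-ξ : ℝ))) * g y)]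
  rfl

theorem norm_bihamIntegrand_mul_fourierInt_le (hw0 : 0 ≤ w.re) (hw1 : w.re ≤ 1) {y ξ : ℝ}
    (hξ : ξ ∈ Set.Icc (-R) R) :
    ‖bihamIntegrand w t y ξ * fourierInt f ξ‖ ≤ (1 + R) * ∫ x, ‖f x‖ := by
  have := norm_bihamIntegrand_le hw0 hw1 hξ (t := t) (x := y)
  rw [norm_mul]
  exact mul_le_mul this (norm_fourierInt_le f ξ) (norm_nonneg _) ((norm_nonneg _).trans this)

theorem bihamForm_eq_integral_mul (hw0 : 0 ≤ w.re) (hw1 : w.re ≤ 1) (hf : Integrable f)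
    (hg : Integrable g) : bihamForm w t R f g =
      ∫ y, (∫ ξ in Set.Icc (-R) R, bihamIntegrand w t y ξ * fourierInt f ξ) * g y := by
  have hm : Measurable fun p : ℝ × ℝ => bihamIntegrand w t p.2 p.1 := by
    unfold bihamIntegrand; fun_prop
  rw [bihamForm_eq_integral_fourierInt hw0 hw1 hf hg]
  have e : ∀ ξ : ℝ, bihamIntegrand w t 0 ξ * (fourierInt f ξ * fourierInt g (-ξ)) =
      ∫ y, (bihamIntegrand w t y ξ * fourierInt f ξ) * g y := fun ξ => by
    rw [fourierInt.eq_def g, ← integral_const_mul, ← integral_const_mul]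
    congr 1 with y
    rw [bihamIntegrand_eq_zero_mul w t y ξ]
    ring
  simp only [e]
  rw [integral_integral_swap]
  · simp only [integral_mul_const]
  · refine (hg.comp_snd _).bdd_mul (c := (1 + R) * ∫ x, ‖f x‖)
      (f := fun p : ℝ × ℝ => bihamIntegrand w t p.2 p.1 * fourierInt f p.1)
      (hm.mul ((continuous_fourierInt hf).measurable.comp measurable_fst)).aestronglyMeasurable ?_
    filter_upwards [ae_fst_mem_Icc _ R] with p hp
    exact norm_bihamIntegrand_mul_fourierInt_le hw0 hw1 hp

theorem norm_bihamForm_le_of_re_eq_zero (hw : w.re = 0) (hf : Integrable f) (hg : Integrable g)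
    {U V : ℝ} (hU : 0 ≤ U) (hV : 0 ≤ V)
    (hfU : ∫⁻ x, ‖f x‖ₑ ^ 2 ≤ ENNReal.ofReal U) (hgV : ∫⁻ x, ‖g x‖ₑ ^ 2 ≤ ENNReal.ofReal V) :
    ‖bihamForm w t R f g‖ ≤ 4 * Real.pi * Real.exp 1 * (U ^ (1 / 2 : ℝ) * V ^ (1 / 2 : ℝ)) := by
  set K : ℝ := 4 * Real.pi * Real.exp 1 with hK
  have hK0 : 0 ≤ K := by positivity
  have hnorm : ∀ᵐ ξ ∂(volume.restrict (Set.Icc (-R) R)), ‖bihamIntegrand w t 0 ξ‖ₑ = 1 := by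
    have : ∀ᵐ ξ : ℝ, ξ ≠ 0 := by simp [ae_iff]
    filter_upwards [ae_restrict_of_ae this] with ξ hξ
    rw [← ofReal_norm, norm_bihamIntegrand hξ, hw]; simp
  have hf2 := (lintegral_Icc_fourierInt_sq_le hf R).trans (mul_le_mul_right hfU _)
  have hg2 : ∫⁻ ξ in Set.Icc (-R) R, ‖fourierInt g (-ξ)‖ₑ ^ 2 ≤
      ENNReal.ofReal K * ENNReal.ofReal V := by
    refine le_trans (le_of_eq ?_) ((lintegral_Icc_fourierInt_sq_le hg R).trans
      (mul_le_mul_right hgV _))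
    have := (Measure.measurePreserving_neg (volume : Measure ℝ)).setLIntegral_comp_preimage_emb
      (MeasurableEquiv.neg ℝ).measurableEmbedding (fun ξ => ‖fourierInt g ξ‖ₑ ^ 2)
      (Set.Icc (-R) R)
    simpa using this
  have hmf : AEMeasurable (fun ξ => ‖fourierInt f ξ‖ₑ) (volume.restrict (Set.Icc (-R) R)) :=
    (continuous_fourierInt hf).enorm.measurable.aemeasurable
  have hmg : AEMeasurable (fun ξ => ‖fourierInt g (-ξ)‖ₑ) (volume.restrict (Set.Icc (-R) R)) :=
    ((continuous_fourierInt hg).comp continuous_neg).enorm.measurable.aemeasurable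
  have key : ‖bihamForm w t R f g‖ₑ ≤ ENNReal.ofReal (K * (U ^ (1 / 2 : ℝ) * V ^ (1 / 2 : ℝ))) := by
    rw [bihamForm_eq_integral_fourierInt hw.ge (by rw [hw]; exact zero_le_one) hf hg]
    calc _ ≤ ∫⁻ ξ in Set.Icc (-R) R,
          ‖bihamIntegrand w t 0 ξ * (fourierInt f ξ * fourierInt g (-ξ))‖ₑ :=
          enorm_integral_le_lintegral_enorm _
      _ = ∫⁻ ξ in Set.Icc (-R) R, ‖fourierInt f ξ‖ₑ * ‖fourierInt g (-ξ)‖ₑ := by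
          refine lintegral_congr_ae ?_
          filter_upwards [hnorm] with ξ hξ
          rw [enorm_mul, enorm_mul, hξ, one_mul]
      _ ≤ (∫⁻ ξ in Set.Icc (-R) R, ‖fourierInt f ξ‖ₑ ^ (2 : ℝ)) ^ (1 / 2 : ℝ) *
          (∫⁻ ξ in Set.Icc (-R) R, ‖fourierInt g (-ξ)‖ₑ ^ (2 : ℝ)) ^ (1 / 2 : ℝ) :=
          ENNReal.lintegral_mul_le_Lp_mul_Lq _ Real.HolderConjugate.two_two hmf hmg
      _ ≤ (ENNReal.ofReal K * ENNReal.ofReal U) ^ (1 / 2 : ℝ) *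
          (ENNReal.ofReal K * ENNReal.ofReal V) ^ (1 / 2 : ℝ) := by
          simp only [ENNReal.rpow_ofNat]
          gcongr
      _ = ENNReal.ofReal (K * (U ^ (1 / 2 : ℝ) * V ^ (1 / 2 : ℝ))) := by
          rw [← ENNReal.ofReal_mul hK0, ← ENNReal.ofReal_mul hK0,
            ENNReal.ofReal_rpow_of_nonneg (by positivity) (by norm_num),
            ENNReal.ofReal_rpow_of_nonneg (by positivity) (by norm_num),
            ← ENNReal.ofReal_mul (by positivity), Real.mul_rpow hK0 hU, Real.mul_rpow hK0 hV]
          congr 1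
          have : K ^ (1 / 2 : ℝ) * K ^ (1 / 2 : ℝ) = K := by
            rw [← Real.sqrt_eq_rpow, Real.mul_self_sqrt hK0]
          linear_combination (U ^ (1 / 2 : ℝ) * V ^ (1 / 2 : ℝ)) * this
  rwa [← ofReal_norm, ENNReal.ofReal_le_ofReal_iff (by positivity)] at key

theorem norm_bihamForm_le_kernel (hw0 : 0 ≤ w.re) (hw1 : w.re ≤ 1) (hf : Integrable f)
    (hg : Integrable g) (ht : t ≠ 0) (hR : 0 ≤ R) :
    ‖bihamForm w t R f g‖ ≤
      18 * (1 + ‖w‖) * |t| ^ (-((1 + w.re) / 4)) * ((∫ x, ‖f x‖) * ∫ x, ‖g x‖) := by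
  rw [bihamForm_eq_integral_kernel hw0 hw1 hf hg, ← integral_prod_mul (μ := volume) (ν := volume)
    (fun x => ‖f x‖) (fun y => ‖g y‖), ← integral_const_mul]
  refine norm_integral_le_of_norm_le ((hf.norm.mul_prod hg.norm).const_mul _)
    (Filter.Eventually.of_forall fun p => ?_)
  rw [norm_mul, norm_mul]
  gcongr
  exact norm_integral_bihamIntegrand_le hw0 hw1 ht _ hR

end Form

/-- The analytic family `a * u ^ (1 + z)`. -/
noncomputable def powerFamily (a : ℝ → ℂ) (u : ℝ → ℝ) (z : ℂ) (x : ℝ) : ℂ :=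
  a x * u x * cexp (z * Real.log (u x))

section Stein

variable {a b : ℝ → ℂ} {u v : ℝ → ℝ} {t R α : ℝ}

theorem measurable_powerFamily (ha : Measurable a) (hu : Measurable u) (z : ℂ) :
    Measurable (powerFamily a u z) := by
  unfold powerFamily
  fun_prop

theorem norm_powerFamily_le (ha1 : ∀ x, ‖a x‖ ≤ 1) (hu0 : ∀ x, 0 ≤ u x) (z : ℂ) (x : ℝ) :
    ‖powerFamily a u z x‖ ≤ u x * u x ^ z.re := by
  rcases (hu0 x).eq_or_lt with h | h
  · simp [powerFamily, ← h]
  · rw [powerFamily, norm_mul, norm_mul, norm_cexp_mul_log h, norm_real, Real.norm_of_nonneg h.le]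
    have := ha1 x
    have h2 : 0 ≤ u x ^ z.re := Real.rpow_nonneg h.le _
    nlinarith [mul_nonneg h.le h2]

theorem integrable_powerFamily (ha : Measurable a) (ha1 : ∀ x, ‖a x‖ ≤ 1) (hu : Measurable u)
    (hu0 : ∀ x, 0 ≤ u x) (hu1 : Integrable u) (hu2 : Integrable fun x => u x ^ 2) {z : ℂ}
    (h0 : 0 ≤ z.re) (h1 : z.re ≤ 1) : Integrable (powerFamily a u z) := by
  refine (hu1.add hu2).mono' (measurable_powerFamily ha hu z).aestronglyMeasurable
    (Filter.Eventually.of_forall fun x => (norm_powerFamily_le ha1 hu0 z x).trans ?_)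
  have h : u x ^ z.re ≤ 1 + u x := by
    calc u x ^ z.re ≤ (1 + u x) ^ z.re := Real.rpow_le_rpow (hu0 x) (by linarith) h0
      _ ≤ (1 + u x) ^ (1 : ℝ) := Real.rpow_le_rpow_of_exponent_le (by linarith [hu0 x]) h1
      _ = 1 + u x := Real.rpow_one _
  simp only [Pi.add_apply]
  nlinarith [hu0 x]

theorem lintegral_enorm_powerFamily_sq_le (ha1 : ∀ x, ‖a x‖ ≤ 1)
    (hu0 : ∀ x, 0 ≤ u x) (hu2 : Integrable fun x => u x ^ 2) {z : ℂ} (hz : z.re = 0) :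
    ∫⁻ x, ‖powerFamily a u z x‖ₑ ^ 2 ≤ ENNReal.ofReal (∫ x, u x ^ 2) := by
  rw [ofReal_integral_eq_lintegral_ofReal hu2 (Filter.Eventually.of_forall fun x => sq_nonneg _)]
  refine lintegral_mono fun x => ?_
  rw [← ofReal_norm, ← ENNReal.ofReal_pow (norm_nonneg _)]
  refine ENNReal.ofReal_le_ofReal (pow_le_pow_left₀ (norm_nonneg _) ?_ 2)
  simpa [hz] using norm_powerFamily_le ha1 hu0 z x

theorem integral_norm_powerFamily_le (ha1 : ∀ x, ‖a x‖ ≤ 1)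
    (hu0 : ∀ x, 0 ≤ u x) (hu2 : Integrable fun x => u x ^ 2) {z : ℂ} (hz : z.re = 1) :
    ∫ x, ‖powerFamily a u z x‖ ≤ ∫ x, u x ^ 2 := by
  refine integral_mono_of_nonneg (Filter.Eventually.of_forall fun x => norm_nonneg _) hu2
    (Filter.Eventually.of_forall fun x => ?_)
  simpa [hz, sq] using norm_powerFamily_le ha1 hu0 z x

theorem bihamForm_powerFamily_eq (z : ℂ) :
    bihamForm (α * z) t R (powerFamily a u z) (powerFamily b v z) =
      ∫ ω : ℝ × ℝ × ℝ, (bihamIntegrand 0 t (ω.2.2 - ω.2.1) ω.1 *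
        (powerFamily a u 0 ω.2.1 * powerFamily b v 0 ω.2.2)) *
        cexp (z * (α * Real.log ω.1 + Real.log (u ω.2.1) + Real.log (v ω.2.2) : ℝ))
        ∂((volume.restrict (Set.Icc (-R) R)).prod (volume.prod volume)) := by
  rw [bihamForm]
  congr 1 with ω
  simp only [bihamIntegrand, powerFamily, zero_mul, Complex.exp_zero, mul_one, one_mul]
  push_cast
  rw [show z * (α * (Real.log ω.1 : ℂ) + Real.log (u ω.2.1) + Real.log (v ω.2.2)) =
    α * z * Real.log ω.1 + z * Real.log (u ω.2.1) + z * Real.log (v ω.2.2) by ring,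
    Complex.exp_add, Complex.exp_add]
  ring

/-- Stein interpolation between the energy bound and the dispersive bound. -/
theorem norm_bihamForm_powerFamily_le (hα0 : 0 ≤ α) (hα1 : α ≤ 1) (ht : t ≠ 0) (hR : 0 ≤ R)
    (ha : Measurable a) (ha1 : ∀ x, ‖a x‖ ≤ 1) (hb : Measurable b) (hb1 : ∀ x, ‖b x‖ ≤ 1)
    (hu : Measurable u) (hu0 : ∀ x, 0 ≤ u x) (hu1 : Integrable u)
    (hu2 : Integrable fun x => u x ^ 2)
    (hv : Measurable v) (hv0 : ∀ x, 0 ≤ v x) (hv1 : Integrable v)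
    (hv2 : Integrable fun x => v x ^ 2) {θ : ℝ} (hθ0 : 0 ≤ θ) (hθ1 : θ ≤ 1) :
    ‖bihamForm (α * θ) t R (powerFamily a u θ) (powerFamily b v θ)‖ ≤
      9 * ((4 * Real.pi * Real.exp 1 *
        ((∫ x, u x ^ 2) ^ (1 / 2 : ℝ) * (∫ x, v x ^ 2) ^ (1 / 2 : ℝ))) ^ (1 - θ) *
        (18 * |t| ^ (-((1 + α) / 4)) * ((∫ x, u x ^ 2) * ∫ x, v x ^ 2)) ^ θ) := by
  set U := ∫ x, u x ^ 2
  set V := ∫ x, v x ^ 2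
  have hU : 0 ≤ U := integral_nonneg fun x => sq_nonneg _
  have hV : 0 ≤ V := integral_nonneg fun x => sq_nonneg _
  set A : ℝ × ℝ × ℝ → ℂ := fun ω => bihamIntegrand 0 t (ω.2.2 - ω.2.1) ω.1 *
        (powerFamily a u 0 ω.2.1 * powerFamily b v 0 ω.2.2) with hA
  set L : ℝ × ℝ × ℝ → ℝ :=
    fun ω => α * Real.log ω.1 + Real.log (u ω.2.1) + Real.log (v ω.2.2) with hL
  have hLm : Measurable L := by fun_prop
  have hre : ∀ z : ℂ, 0 ≤ z.re → z.re ≤ 1 → 0 ≤ (α * z).re ∧ (α * z).re ≤ 1 := fun z h0 h1 => by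
    rw [re_ofReal_mul]; constructor <;> nlinarith
  have hf : ∀ z : ℂ, 0 ≤ z.re → z.re ≤ 1 → Integrable (powerFamily a u z) := fun z h0 h1 =>
    integrable_powerFamily ha ha1 hu hu0 hu1 hu2 h0 h1
  have hg : ∀ z : ℂ, 0 ≤ z.re → z.re ≤ 1 → Integrable (powerFamily b v z) := fun z h0 h1 =>
    integrable_powerFamily hb hb1 hv hv0 hv1 hv2 h0 h1
  have hA0 : Integrable A ((volume.restrict (Set.Icc (-R) R)).prod (volume.prod volume)) :=
    integrable_bihamForm (by simp) (by simp) (hf 0 (by simp) (by simp)) (hg 0 (by simp) (by simp))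
  have hA1 : Integrable (fun ω => ‖A ω‖ * Real.exp (L ω))
      ((volume.restrict (Set.Icc (-R) R)).prod (volume.prod volume)) := by
    have h := integrable_bihamForm (t := t) (R := R) (w := α * 1) (by simpa) (by simpa)
      (hf 1 (by simp) (by simp)) (hg 1 (by simp) (by simp))
    refine h.norm.congr (Filter.Eventually.of_forall fun ω => ?_)
    simp only [bihamIntegrand, powerFamily, hA, hL, norm_mul, zero_mul, Complex.exp_zero, one_mul,
      mul_one, ← ofReal_mul, ← ofReal_exp, norm_real, Real.norm_of_nonneg (Real.exp_nonneg _)]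
    rw [Real.exp_add, Real.exp_add]
    ring
  have hΦd := diffContOnCl_integral_mul_cexp hLm hA0 hA1
  have hΦb : ∀ z : ℂ, 0 ≤ z.re → z.re ≤ 1 → _ := fun z h0 h1 =>
    norm_integral_mul_cexp_le hA0 hA1 h0 h1
  have h0 : ∀ z : ℂ, z.re = 0 → ‖bihamForm (α * z) t R (powerFamily a u z) (powerFamily b v z)‖ ≤
      4 * Real.pi * Real.exp 1 * (U ^ (1 / 2 : ℝ) * V ^ (1 / 2 : ℝ)) := fun z hz =>
    norm_bihamForm_le_of_re_eq_zero (by rw [re_ofReal_mul, hz, mul_zero])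
      (hf z hz.ge (by rw [hz]; exact zero_le_one)) (hg z hz.ge (by rw [hz]; exact zero_le_one))
      hU hV (lintegral_enorm_powerFamily_sq_le ha1 hu0 hu2 hz)
      (lintegral_enorm_powerFamily_sq_le hb1 hv0 hv2 hz)
  have h1 : ∀ z : ℂ, z.re = 1 → ‖bihamForm (α * z) t R (powerFamily a u z) (powerFamily b v z)‖ ≤
      18 * |t| ^ (-((1 + α) / 4)) * (U * V) * (2 + |z.im|) := fun z hz => by
    have hz0 : 0 ≤ z.re := by rw [hz]; exact zero_le_one
    refine (norm_bihamForm_le_kernel (hre z hz0 hz.le).1 (hre z hz0 hz.le).2 (hf z hz0 hz.le)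
      (hg z hz0 hz.le) ht hR).trans ?_
    rw [re_ofReal_mul, hz, mul_one]
    have e1 := integral_norm_powerFamily_le ha1 hu0 hu2 hz
    have e2 := integral_norm_powerFamily_le hb1 hv0 hv2 hz
    have e3 : 1 + ‖(α : ℂ) * z‖ ≤ 2 + |z.im| := by
      have : ‖z‖ ≤ 1 + |z.im| := (norm_le_abs_re_add_abs_im z).trans (by rw [hz, abs_one])
      rw [norm_mul, norm_real, Real.norm_of_nonneg hα0]
      nlinarith [norm_nonneg z]
    calc _ ≤ 18 * (2 + |z.im|) * |t| ^ (-((1 + α) / 4)) * (U * V) := by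
          gcongr
      _ = _ := by ring
  simp only [bihamForm_powerFamily_eq] at h0 h1 ⊢
  exact norm_le_of_three_lines_of_linear_growth hΦd hΦb (by positivity) h0 h1 hθ0 hθ1

end Stein

/-- The frequency-truncated biharmonic evolution. -/
noncomputable def truncatedBiham (w : ℂ) (t R : ℝ) (f : ℝ → ℂ) (y : ℝ) : ℂ :=
  ∫ ξ in Set.Icc (-R) R, bihamIntegrand w t y ξ * fourierInt f ξ

section Truncated

variable {w : ℂ} {t R : ℝ} {f : ℝ → ℂ}

theorem measurable_bihamIntegrand_uncurry (w : ℂ) (t : ℝ) :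
    Measurable fun p : ℝ × ℝ => bihamIntegrand w t p.1 p.2 := by
  unfold bihamIntegrand; fun_prop

theorem measurable_truncatedBiham (w : ℂ) (t R : ℝ) (hf : Integrable f) :
    Measurable (truncatedBiham w t R f) := by
  have : StronglyMeasurable (Function.uncurry fun y ξ : ℝ =>
      bihamIntegrand w t y ξ * fourierInt f ξ) :=
    ((measurable_bihamIntegrand_uncurry w t).mul
      ((continuous_fourierInt hf).measurable.comp measurable_snd)).stronglyMeasurable
  exact (this.integral_prod_right (ν := volume.restrict (Set.Icc (-R) R))).measurable

theorem norm_truncatedBiham_le (hw0 : 0 ≤ w.re) (hw1 : w.re ≤ 1) (y : ℝ) :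
    ‖truncatedBiham w t R f y‖ ≤
      ((1 + R) * ∫ x, ‖f x‖) * (volume : Measure ℝ).real (Set.Icc (-R) R) :=
  norm_setIntegral_le_of_norm_le_const measure_Icc_lt_top fun _ hξ =>
    norm_bihamIntegrand_mul_fourierInt_le hw0 hw1 hξ

/-- The dispersive estimate from `L¹` to `L^∞`. -/
theorem norm_truncatedBiham_le_kernel (hw0 : 0 ≤ w.re) (hw1 : w.re ≤ 1) (hf : Integrable f)
    (ht : t ≠ 0) (hR : 0 ≤ R) (y : ℝ) :
    ‖truncatedBiham w t R f y‖ ≤ 18 * (1 + ‖w‖) * |t| ^ (-((1 + w.re) / 4)) * ∫ x, ‖f x‖ := by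
  have e : truncatedBiham w t R f y =
      ∫ x, (∫ ξ in Set.Icc (-R) R, bihamIntegrand w t (y - x) ξ) * f x := by
    have e1 : ∀ ξ : ℝ, bihamIntegrand w t y ξ * fourierInt f ξ =
        ∫ x, bihamIntegrand w t (y - x) ξ * f x := fun ξ => by
      rw [fourierInt, ← integral_const_mul]
      simp only [bihamIntegrand_sub, mul_assoc]
    rw [truncatedBiham]
    simp only [e1]
    rw [integral_integral_swap]
    · simp only [integral_mul_const]
    · have hm : Measurable fun p : ℝ × ℝ => bihamIntegrand w t (y - p.2) p.1 := by
        unfold bihamIntegrand; fun_prop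
      refine (hf.comp_snd _).bdd_mul (c := 1 + R)
        (f := fun p : ℝ × ℝ => bihamIntegrand w t (y - p.2) p.1) hm.aestronglyMeasurable ?_
      filter_upwards [ae_fst_mem_Icc _ R] with p hp
      exact norm_bihamIntegrand_le hw0 hw1 hp
  rw [e, ← integral_const_mul]
  refine norm_integral_le_of_norm_le (hf.norm.const_mul _) (Filter.Eventually.of_forall fun x => ?_)
  rw [norm_mul]
  gcongr
  exact norm_integral_bihamIntegrand_le hw0 hw1 ht _ hR

end Truncated

theorem powerFamily_rpow_norm {θ : ℝ} (hθ : 0 ≤ θ) (f : ℝ → ℂ) :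
    powerFamily (fun x => f x / ‖f x‖) (fun x => ‖f x‖ ^ (1 / (1 + θ))) θ = f := by
  funext x
  have hθ' : 1 + θ ≠ 0 := by positivity
  rcases eq_or_ne (f x) 0 with h | h
  · simp [powerFamily, h]
  have hn : 0 < ‖f x‖ := norm_pos_iff.2 h
  have hu : 0 < ‖f x‖ ^ (1 / (1 + θ)) := Real.rpow_pos_of_pos hn _
  have e : ‖f x‖ ^ (1 / (1 + θ)) * Real.exp (θ * Real.log (‖f x‖ ^ (1 / (1 + θ)))) = ‖f x‖ := by
    rw [mul_comm θ, ← Real.rpow_def_of_pos hu]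
    nth_rw 1 [← Real.rpow_one (‖f x‖ ^ (1 / (1 + θ)))]
    rw [← Real.rpow_add hu, ← Real.rpow_mul hn.le, one_div_mul_cancel hθ', Real.rpow_one]
  rw [powerFamily, mul_assoc, ← ofReal_mul, ← ofReal_exp, ← ofReal_mul, e]
  exact div_mul_cancel₀ _ (by exact_mod_cast hn.ne')

section Dispersive

variable {f : ℝ → ℂ} {t R α θ : ℝ}

theorem measurable_div_norm (hf : Measurable f) : Measurable fun x => f x / (‖f x‖ : ℂ) := by
  fun_prop

theorem norm_div_norm_le (f : ℝ → ℂ) (x : ℝ) : ‖f x / (‖f x‖ : ℂ)‖ ≤ 1 := by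
  rw [norm_div, norm_real, norm_norm]
  exact div_self_le_one _

theorem rpow_one_div_sq (θ : ℝ) (f : ℝ → ℂ) (x : ℝ) :
    (‖f x‖ ^ (1 / (1 + θ))) ^ 2 = ‖f x‖ ^ (2 / (1 + θ)) := by
  rw [← Real.rpow_natCast, ← Real.rpow_mul (norm_nonneg _)]
  congr 1; push_cast; ring

theorem integrable_of_integrable_rpow (hθ0 : 0 ≤ θ) (hθ1 : θ ≤ 1) (hf : Measurable f)
    (hf1 : Integrable fun x => ‖f x‖ ^ (1 / (1 + θ)))
    (hf2 : Integrable fun x => ‖f x‖ ^ (2 / (1 + θ))) : Integrable f := by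
  rw [← powerFamily_rpow_norm hθ0 f]
  exact integrable_powerFamily (measurable_div_norm hf) (norm_div_norm_le f) (by fun_prop)
    (fun x => Real.rpow_nonneg (norm_nonneg _) _) hf1 (by simpa only [rpow_one_div_sq])
    (by simpa) (by simpa)

/-- The interpolated bilinear estimate. -/
theorem norm_integral_truncatedBiham_mul_le {g : ℝ → ℂ} (hα0 : 0 ≤ α) (hα1 : α ≤ 1) (ht : t ≠ 0)
    (hR : 0 ≤ R) (hθ0 : 0 ≤ θ) (hθ1 : θ ≤ 1) (hf : Measurable f)
    (hf1 : Integrable fun x => ‖f x‖ ^ (1 / (1 + θ)))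
    (hf2 : Integrable fun x => ‖f x‖ ^ (2 / (1 + θ))) (hg : Measurable g)
    (hg1 : Integrable fun x => ‖g x‖ ^ (1 / (1 + θ)))
    (hg2 : Integrable fun x => ‖g x‖ ^ (2 / (1 + θ))) :
    ‖∫ y, truncatedBiham (α * θ) t R f y * g y‖ ≤
      9 * ((4 * Real.pi * Real.exp 1) ^ (1 - θ) * 18 ^ θ) * |t| ^ (-((1 + α) * θ / 4)) *
        ((∫ x, ‖f x‖ ^ (2 / (1 + θ))) ^ ((1 + θ) / 2) *
          (∫ x, ‖g x‖ ^ (2 / (1 + θ))) ^ ((1 + θ) / 2)) := by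
  have hre0 : 0 ≤ ((α : ℂ) * θ).re := by rw [re_ofReal_mul, ofReal_re]; positivity
  have hre1 : ((α : ℂ) * θ).re ≤ 1 := by rw [re_ofReal_mul, ofReal_re]; nlinarith
  have h := norm_bihamForm_powerFamily_le hα0 hα1 ht hR (measurable_div_norm hf)
    (norm_div_norm_le f) (measurable_div_norm hg) (norm_div_norm_le g)
    (u := fun x => ‖f x‖ ^ (1 / (1 + θ))) (v := fun x => ‖g x‖ ^ (1 / (1 + θ)))
    (by fun_prop) (fun x => Real.rpow_nonneg (norm_nonneg _) _) hf1
    (by simpa only [rpow_one_div_sq]) (by fun_prop)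
    (fun x => Real.rpow_nonneg (norm_nonneg _) _) hg1 (by simpa only [rpow_one_div_sq]) hθ0 hθ1
  rw [powerFamily_rpow_norm hθ0, powerFamily_rpow_norm hθ0, bihamForm_eq_integral_mul hre0 hre1
    (integrable_of_integrable_rpow hθ0 hθ1 hf hf1 hf2)
    (integrable_of_integrable_rpow hθ0 hθ1 hg hg1 hg2)] at h
  simp only [rpow_one_div_sq] at h
  refine h.trans (le_of_eq ?_)
  set U := ∫ x, ‖f x‖ ^ (2 / (1 + θ))
  set V := ∫ x, ‖g x‖ ^ (2 / (1 + θ))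
  have hU : 0 ≤ U := integral_nonneg fun x => Real.rpow_nonneg (norm_nonneg _) _
  have hV : 0 ≤ V := integral_nonneg fun x => Real.rpow_nonneg (norm_nonneg _) _
  have hpow : ∀ W : ℝ, 0 ≤ W → W ^ ((1 + θ) / 2) = (W ^ (1 / 2 : ℝ)) ^ (1 - θ) * W ^ θ := by
    intro W hW
    rw [← Real.rpow_mul hW, ← Real.rpow_add_of_nonneg hW (by linarith) hθ0]
    congr 1; ring
  have htp : |t| ^ (-((1 + α) * θ / 4)) = (|t| ^ (-((1 + α) / 4))) ^ θ := by
    rw [← Real.rpow_mul (abs_nonneg t)]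
    congr 1; ring
  rw [hpow U hU, hpow V hV, htp, Real.mul_rpow (x := 4 * Real.pi * Real.exp 1) (by positivity)
      (by positivity), Real.mul_rpow (x := U ^ (1 / 2 : ℝ)) (by positivity) (by positivity),
    Real.mul_rpow (x := 18 * |t| ^ (-((1 + α) / 4))) (by positivity) (by positivity),
    Real.mul_rpow (x := 18) (by positivity) (by positivity), Real.mul_rpow hU hV]
  ring

theorem holderConjugate_dispersive (hθ0 : 0 ≤ θ) (hθ1 : θ < 1) :
    (2 / (1 - θ)).HolderConjugate (2 / (1 + θ)) := by
  have h : 0 < 1 - θ := by linarith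
  have h' : 0 < 1 + θ := by linarith
  refine Real.holderConjugate_iff.2 ⟨?_, ?_⟩
  · rw [lt_div_iff₀ h]; linarith
  · rw [inv_div, inv_div]; ring

theorem integrable_rpow_of_bounded {g : ℝ → ℂ} (hg : Measurable g) {M : ℝ}
    (hM : ∀ x, ‖g x‖ ≤ M) {S : Set ℝ} (hS : volume S < ∞)
    (hgS : ∀ x ∉ S, g x = 0) {s : ℝ} (hs : 0 < s) : Integrable fun x => ‖g x‖ ^ s := by
  have h1 : IntegrableOn (fun x => ‖g x‖ ^ s) S := by
    refine Measure.integrableOn_of_bounded hS.ne (by fun_prop : Measurable _).aestronglyMeasurable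
      (M := M ^ s) (Filter.Eventually.of_forall fun x => ?_)
    rw [Real.norm_of_nonneg (Real.rpow_nonneg (norm_nonneg _) _)]
    exact Real.rpow_le_rpow (norm_nonneg _) (hM x) hs.le
  refine h1.integrable_of_forall_notMem_eq_zero fun x hx => ?_
  rw [hgS x hx, norm_zero, Real.zero_rpow hs.ne']

theorem ofReal_integral_norm_rpow {g : ℝ → ℂ} {s : ℝ} (hs : 0 < s)
    (hg : Integrable fun x => ‖g x‖ ^ s) :
    ENNReal.ofReal (∫ x, ‖g x‖ ^ s) = ∫⁻ x, ‖g x‖ₑ ^ s := by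
  rw [ofReal_integral_eq_lintegral_ofReal hg
    (Filter.Eventually.of_forall fun x => Real.rpow_nonneg (norm_nonneg _) _)]
  refine lintegral_congr fun x => ?_
  rw [← ofReal_norm, ENNReal.ofReal_rpow_of_nonneg (norm_nonneg _) hs.le]

/-- The constant in the interpolated dispersive estimate. -/
noncomputable def dispersiveConst (θ : ℝ) : ℝ :=
  9 * ((4 * Real.pi * Real.exp 1) ^ (1 - θ) * 18 ^ θ)

theorem dispersiveConst_pos (θ : ℝ) : 0 < dispersiveConst θ := by
  unfold dispersiveConst; positivity

/-- The dispersive estimate for the truncated evolution. -/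
theorem lintegral_truncatedBiham_rpow_le (hα0 : 0 ≤ α) (hα1 : α ≤ 1) (ht : t ≠ 0)
    (hR : 0 ≤ R) (hθ0 : 0 ≤ θ) (hθ1 : θ < 1) (hf : Measurable f)
    (hf1 : Integrable fun x => ‖f x‖ ^ (1 / (1 + θ)))
    (hf2 : Integrable fun x => ‖f x‖ ^ (2 / (1 + θ))) :
    (∫⁻ y, ‖truncatedBiham (α * θ) t R f y‖ₑ ^ (2 / (1 - θ))) ^ (1 / (2 / (1 - θ))) ≤
      ENNReal.ofReal (dispersiveConst θ * |t| ^ (-((1 + α) * θ / 4))) *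
        (∫⁻ x, ‖f x‖ₑ ^ (2 / (1 + θ))) ^ (1 / (2 / (1 + θ))) := by
  have hre0 : 0 ≤ ((α : ℂ) * θ).re := by rw [re_ofReal_mul, ofReal_re]; positivity
  have hre1 : ((α : ℂ) * θ).re ≤ 1 := by rw [re_ofReal_mul, ofReal_re]; nlinarith
  have hC := dispersiveConst_pos θ
  have hfi := integrable_of_integrable_rpow hθ0 hθ1.le hf hf1 hf2
  have hTm := measurable_truncatedBiham (α * θ) t R hfi
  set T := truncatedBiham (α * θ) t R f with hT
  refine lintegral_rpow_le_of_forall_lintegral_mul_le volume (holderConjugate_dispersive hθ0 hθ1)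
    hTm.enorm _ fun g hg ⟨M, hM⟩ ⟨S, hS, hSf, hgS⟩ => ?_
  set G : ℝ → ℂ := fun y => (starRingEnd ℂ) (T y) / ‖T y‖ * ((g y).toReal : ℂ) with hG
  have hGm : Measurable G := by fun_prop
  have hGn : ∀ y, ‖G y‖ ≤ (g y).toReal := fun y => by
    rw [hG, norm_mul, norm_real, Real.norm_of_nonneg ENNReal.toReal_nonneg, norm_div,
      RCLike.norm_conj, norm_real, norm_norm]
    exact mul_le_of_le_one_left ENNReal.toReal_nonneg (div_self_le_one _)
  have hgM : ∀ y, (g y).toReal ≤ max M 0 := fun y => by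
    rw [← ENNReal.toReal_ofReal']
    exact ENNReal.toReal_mono ENNReal.ofReal_ne_top (hM y)
  have hGS : ∀ y ∉ S, G y = 0 := fun y hy => by simp [hG, hgS y hy]
  have hGb : ∀ y, ‖G y‖ ≤ max M 0 := fun y => (hGn y).trans (hgM y)
  have hg1 := integrable_rpow_of_bounded hGm hGb hSf hGS (s := 1 / (1 + θ)) (by positivity)
  have hg2 := integrable_rpow_of_bounded hGm hGb hSf hGS (s := 2 / (1 + θ)) (by positivity)
  have hGi := integrable_of_integrable_rpow hθ0 hθ1.le hGm hg1 hg2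
  have key := norm_integral_truncatedBiham_mul_le hα0 hα1 ht hR hθ0 hθ1.le hf hf1 hf2 hGm hg1 hg2
  rw [← hT] at key
  have hTG : ∀ y, T y * G y = ((‖T y‖ * (g y).toReal : ℝ) : ℂ) := fun y => by
    rcases eq_or_ne (T y) 0 with h | h
    · simp [h]
    · have h2 : (‖T y‖ : ℂ) ≠ 0 := by exact_mod_cast norm_ne_zero_iff.2 h
      simp only [hG]
      rw [← mul_assoc, ← mul_div_assoc, mul_conj', sq, mul_div_assoc, div_self h2, mul_one]
      push_cast; rfl
  have hTi : Integrable fun y => T y * G y :=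
    hGi.bdd_mul hTm.aestronglyMeasurable
      (Filter.Eventually.of_forall (norm_truncatedBiham_le hre0 hre1))
  have hlhs : ∫⁻ y, ‖T y‖ₑ * g y = ENNReal.ofReal ‖∫ y, T y * G y‖ := by
    have hn : ∀ y, 0 ≤ ‖T y‖ * (g y).toReal := fun y =>
      mul_nonneg (norm_nonneg _) ENNReal.toReal_nonneg
    simp only [hTG] at hTi ⊢
    rw [integral_complex_ofReal, norm_real, Real.norm_of_nonneg (integral_nonneg hn),
      ofReal_integral_eq_lintegral_ofReal _ (Filter.Eventually.of_forall hn)]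
    · refine lintegral_congr fun y => ?_
      rw [ENNReal.ofReal_mul (norm_nonneg _), ofReal_norm,
        ENNReal.ofReal_toReal ((hM y).trans_lt ENNReal.ofReal_lt_top).ne]
    · simpa using hTi.re
  have hp : 0 < 2 / (1 + θ) := by positivity
  have hinv : 1 / (2 / (1 + θ)) = (1 + θ) / 2 := one_div_div _ _
  rw [hlhs, ← ofReal_integral_norm_rpow hp hf2]
  have hU : 0 ≤ ∫ x, ‖f x‖ ^ (2 / (1 + θ)) :=
    integral_nonneg fun x => Real.rpow_nonneg (norm_nonneg _) _
  have hV : 0 ≤ ∫ x, ‖G x‖ ^ (2 / (1 + θ)) :=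
    integral_nonneg fun x => Real.rpow_nonneg (norm_nonneg _) _
  have hK : 0 ≤ dispersiveConst θ * |t| ^ (-((1 + α) * θ / 4)) := by positivity
  change _ ≤ dispersiveConst θ * _ * _ at key
  refine (ENNReal.ofReal_le_ofReal key).trans ?_
  rw [ENNReal.ofReal_mul hK, ENNReal.ofReal_mul (Real.rpow_nonneg hU _), ← mul_assoc, hinv,
    ← ENNReal.ofReal_rpow_of_nonneg hU (by positivity),
    ← ENNReal.ofReal_rpow_of_nonneg hV (by positivity), ofReal_integral_norm_rpow hp hg2]
  refine mul_le_mul' (le_of_eq rfl) (ENNReal.rpow_le_rpow (lintegral_mono fun y =>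
    ENNReal.rpow_le_rpow ?_ hp.le) (by positivity))
  rw [← ofReal_norm]
  exact ENNReal.ofReal_le_of_le_toReal (hGn y)

end Dispersive

section Untruncated

open Filter Topology

variable {f : ℝ → ℂ} {t α θ : ℝ}

theorem bihamIntegrand_ofReal (β t x : ℝ) {ξ : ℝ} (hξ : ξ ≠ 0) :
    bihamIntegrand β t x ξ =
      ((|ξ| ^ β : ℝ) : ℂ) * cexp (I * (x * ξ + t * ξ ^ 4)) := by
  rw [bihamIntegrand, Real.rpow_def_of_pos (abs_pos.2 hξ), Real.log_abs, mul_comm (Real.log ξ)]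
  push_cast; rfl

theorem DbihamGroup_eq_integral_bihamIntegrand (β t : ℝ) (f : ℝ → ℂ) (y : ℝ) :
    DbihamGroup β t f y =
      (2 * Real.pi)⁻¹ * ∫ ξ : ℝ, bihamIntegrand β t y ξ * fourierInt f ξ := by
  rw [DbihamGroup]
  congr 1
  refine integral_congr_ae ?_
  filter_upwards [compl_mem_ae_iff.2 (measure_singleton (0 : ℝ))] with ξ hξ
  rw [bihamIntegrand_ofReal β t y hξ]

/-- When the defining integral converges, it is the limit of the truncated evolutions. -/
theorem DbihamGroup_eq_zero_or_tendsto (β t : ℝ) (f : ℝ → ℂ) (y : ℝ) :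
    DbihamGroup β t f y = 0 ∨
      ∃ L : ℂ, ‖DbihamGroup β t f y‖ ≤ ‖L‖ ∧
        Tendsto (fun n : ℕ => truncatedBiham β t n f y) atTop (𝓝 L) := by
  by_cases hi : Integrable fun ξ : ℝ => bihamIntegrand β t y ξ * fourierInt f ξ
  · refine .inr ⟨∫ ξ : ℝ, bihamIntegrand β t y ξ * fourierInt f ξ, ?_, ?_⟩
    · rw [DbihamGroup_eq_integral_bihamIntegrand, norm_mul]
      refine mul_le_of_le_one_left (norm_nonneg _) ?_
      have h1 : (1 : ℝ) ≤ 2 * Real.pi := by linarith [Real.pi_gt_three]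
      have h2 : ‖((2 : ℂ) * Real.pi)⁻¹‖ = (2 * Real.pi)⁻¹ := by
        rw [norm_inv, norm_mul, norm_real, Real.norm_of_nonneg Real.pi_pos.le]; norm_num
      push_cast
      exact h2.trans_le (inv_le_one_of_one_le₀ h1)
    · have hU : ⋃ n : ℕ, Set.Icc (-(n : ℝ)) n = Set.univ := by
        refine Set.eq_univ_of_forall fun x => Set.mem_iUnion.2 ?_
        obtain ⟨n, hn⟩ := exists_nat_ge |x|
        exact ⟨n, abs_le.1 hn⟩
      have hm : Monotone fun n : ℕ => Set.Icc (-(n : ℝ)) n := fun m n hmn =>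
        Set.Icc_subset_Icc (neg_le_neg (Nat.cast_le.2 hmn)) (Nat.cast_le.2 hmn)
      have := tendsto_setIntegral_of_monotone (μ := volume)
        (f := fun ξ : ℝ => bihamIntegrand β t y ξ * fourierInt f ξ)
        (fun n : ℕ => measurableSet_Icc) hm (by rw [hU]; exact hi.integrableOn)
      rwa [hU, setIntegral_univ] at this
  · left
    rw [DbihamGroup_eq_integral_bihamIntegrand, integral_undef hi, mul_zero]

theorem enorm_DbihamGroup_rpow_le_liminf (β t : ℝ) (f : ℝ → ℂ) (y : ℝ) {s : ℝ} (hs : 0 < s) :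
    ‖DbihamGroup β t f y‖ₑ ^ s ≤
      liminf (fun n : ℕ => ‖truncatedBiham β t n f y‖ₑ ^ s) atTop := by
  rcases DbihamGroup_eq_zero_or_tendsto β t f y with h | ⟨L, hL, h⟩
  · rw [h, enorm_zero, ENNReal.zero_rpow_of_pos hs]
    exact zero_le
  · have := ((ENNReal.continuous_rpow_const (y := s)).tendsto _).comp
      ((continuous_enorm.tendsto L).comp h)
    rw [show liminf (fun n : ℕ => ‖truncatedBiham β t n f y‖ₑ ^ s) atTop = ‖L‖ₑ ^ s from
      this.liminf_eq]
    gcongr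
    exact enorm_le_iff_norm_le.2 hL

/-- The dispersive estimate from `L¹` to `L^∞` for the evolution with derivatives. -/
theorem norm_DbihamGroup_le (hα0 : 0 ≤ α) (hα1 : α ≤ 1) (ht : t ≠ 0) (hf : Integrable f) (y : ℝ) :
    ‖DbihamGroup α t f y‖ ≤ 36 * |t| ^ (-((1 + α) / 4)) * ∫ x, ‖f x‖ := by
  have hB : 0 ≤ 36 * |t| ^ (-((1 + α) / 4)) * ∫ x, ‖f x‖ :=
    mul_nonneg (by positivity) (integral_nonneg fun _ => norm_nonneg _)
  rcases DbihamGroup_eq_zero_or_tendsto α t f y with h | ⟨L, hL, h⟩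
  · rwa [h, norm_zero]
  · refine hL.trans (le_of_tendsto h.norm (Eventually.of_forall fun n => ?_))
    refine (norm_truncatedBiham_le_kernel (w := (α : ℂ)) hα0 hα1 hf ht n.cast_nonneg y).trans ?_
    rw [norm_real, Real.norm_of_nonneg hα0, ofReal_re]
    have hI : 0 ≤ ∫ x, ‖f x‖ := integral_nonneg fun _ => norm_nonneg _
    gcongr
    linarith

theorem lintegral_DbihamGroup_rpow_le (hα0 : 0 ≤ α) (hα1 : α ≤ 1) (ht : t ≠ 0)
    (hθ0 : 0 ≤ θ) (hθ1 : θ < 1) (hf : Measurable f)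
    (hf1 : Integrable fun x => ‖f x‖ ^ (1 / (1 + θ)))
    (hf2 : Integrable fun x => ‖f x‖ ^ (2 / (1 + θ))) :
    (∫⁻ y, ‖DbihamGroup (α * θ) t f y‖ₑ ^ (2 / (1 - θ))) ^ (1 / (2 / (1 - θ))) ≤
      ENNReal.ofReal (dispersiveConst θ * |t| ^ (-((1 + α) * θ / 4))) *
        (∫⁻ x, ‖f x‖ₑ ^ (2 / (1 + θ))) ^ (1 / (2 / (1 + θ))) := by
  have hs : 0 < 2 / (1 - θ) := div_pos two_pos (by linarith)
  have hfi := integrable_of_integrable_rpow hθ0 hθ1.le hf hf1 hf2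
  set B := ENNReal.ofReal (dispersiveConst θ * |t| ^ (-((1 + α) * θ / 4))) *
        (∫⁻ x, ‖f x‖ₑ ^ (2 / (1 + θ))) ^ (1 / (2 / (1 + θ))) with hB
  rw [one_div (2 / (1 - θ)), ENNReal.rpow_inv_le_iff hs]
  calc ∫⁻ y, ‖DbihamGroup (α * θ) t f y‖ₑ ^ (2 / (1 - θ))
      ≤ ∫⁻ y, liminf (fun n : ℕ =>
          ‖truncatedBiham ((α * θ : ℝ) : ℂ) t n f y‖ₑ ^ (2 / (1 - θ))) atTop :=
        lintegral_mono fun y => enorm_DbihamGroup_rpow_le_liminf _ _ _ _ hs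
    _ ≤ liminf (fun n : ℕ =>
          ∫⁻ y, ‖truncatedBiham ((α * θ : ℝ) : ℂ) t n f y‖ₑ ^ (2 / (1 - θ))) atTop :=
        lintegral_liminf_le fun n =>
          (measurable_truncatedBiham _ t n hfi).enorm.pow_const _
    _ ≤ B ^ (2 / (1 - θ)) := by
        refine liminf_le_of_le (by isBoundedDefault) fun b hb => ?_
        obtain ⟨n, hn⟩ := hb.exists
        refine hn.trans ?_
        rw [← ENNReal.rpow_inv_le_iff hs, ← one_div, ofReal_mul]
        exact lintegral_truncatedBiham_rpow_le hα0 hα1 ht n.cast_nonneg hθ0 hθ1 hf hf1 hf2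

/-- The exponent dual to `r` in terms of the interpolation parameter `1 - 2 / r`. -/
theorem conjExponent_eq {r r' : ℝ≥0∞} (hr : 2 ≤ r) (hr' : 1 / r + 1 / r' = 1) :
    0 ≤ 1 - 2 / r.toReal ∧ 1 - 2 / r.toReal ≤ 1 ∧
      r' = ENNReal.ofReal (2 / (1 + (1 - 2 / r.toReal))) := by
  rcases eq_or_ne r ∞ with rfl | hrt
  · simp only [one_div, ENNReal.inv_top, zero_add] at hr'
    rw [ENNReal.inv_eq_one] at hr'
    subst hr'
    norm_num
  have h2 : 2 ≤ r.toReal := by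
    simpa using (ENNReal.toReal_le_toReal ENNReal.ofNat_ne_top hrt).2 hr
  have h0 : 0 < r.toReal := by linarith
  have h3 : 2 / r.toReal ≤ 1 := (div_le_one h0).2 h2
  refine ⟨by linarith, by linarith [div_pos two_pos h0], ?_⟩
  have hr0 : 1 / r ≠ ∞ := by
    rw [one_div, ENNReal.inv_ne_top]
    rintro rfl
    simp at h0
  have h4 : r'⁻¹ = ENNReal.ofReal (1 - 1 / r.toReal) := by
    rw [← one_div, ENNReal.eq_sub_of_add_eq' ENNReal.one_ne_top ((add_comm _ _).trans hr'),
      ENNReal.ofReal_sub _ (by positivity), ENNReal.ofReal_one, ENNReal.ofReal_div_of_pos h0,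
      ENNReal.ofReal_one, ENNReal.ofReal_toReal hrt]
  have h5 : 2 / (1 + (1 - 2 / r.toReal)) = (1 - 1 / r.toReal)⁻¹ := by
    have : r.toReal - 1 ≠ 0 := by linarith
    have : 1 - 1 / r.toReal ≠ 0 := by
      rw [one_sub_div h0.ne']; exact div_ne_zero this h0.ne'
    rw [show 1 + (1 - 2 / r.toReal) = 2 * (1 - 1 / r.toReal) by ring]
    field_simp
  rw [h5, ENNReal.ofReal_inv_of_pos, ← h4, inv_inv]
  have : 1 / r.toReal ≤ 1 / 2 := one_div_le_one_div_of_le two_pos h2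
  linarith

/-- The dispersive estimate from `L^{r'}` to `L^r`. -/
theorem eLpNorm_DbihamGroup_le {r r' : ℝ≥0∞} (hr : 2 ≤ r) (hr' : 1 / r + 1 / r' = 1)
    (hα0 : 0 ≤ α) (hα1 : α ≤ 1) (ht : t ≠ 0) (hf : Measurable f)
    (hfi : ∀ s : ℝ, 1 / 2 ≤ s → Integrable fun x => ‖f x‖ ^ s) :
    eLpNorm (DbihamGroup (α * (1 - 2 / r.toReal)) t f) r volume ≤
      ENNReal.ofReal (dispersiveConst (1 - 2 / r.toReal) *
        |t| ^ (-((1 + α) * (1 - 2 / r.toReal) / 4))) * eLpNorm f r' volume := by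
  obtain ⟨hθ0, hθ1, hr'e⟩ := conjExponent_eq hr hr'
  have hf1 : Integrable fun x => ‖f x‖ ^ (1 / (1 + (1 - 2 / r.toReal))) :=
    hfi _ (one_div_le_one_div_of_le (by linarith) (by linarith))
  have hf2 : Integrable fun x => ‖f x‖ ^ (2 / (1 + (1 - 2 / r.toReal))) :=
    hfi _ ((div_le_div_iff₀ two_pos (by linarith)).2 (by linarith))
  have hi := integrable_of_integrable_rpow hθ0 hθ1 hf hf1 hf2
  have hr'p : 0 < 2 / (1 + (1 - 2 / r.toReal)) := by positivity
  rcases eq_or_ne r ∞ with rfl | hrt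
  · have e1 : r' = 1 := by rw [hr'e]; norm_num
    subst e1
    rw [eLpNorm_one_eq_lintegral_enorm, ENNReal.toReal_top, div_zero, sub_zero, mul_one, mul_one,
      ← ofReal_integral_norm_eq_lintegral_enorm hi, ← ENNReal.ofReal_mul
        (mul_nonneg (dispersiveConst_pos _).le (by positivity))]
    refine eLpNormEssSup_le_of_ae_bound (Eventually.of_forall fun y => ?_)
    refine (norm_DbihamGroup_le hα0 hα1 ht hi y).trans ?_
    have hI : 0 ≤ ∫ x, ‖f x‖ := integral_nonneg fun _ => norm_nonneg _
    gcongr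
    norm_num [dispersiveConst]
  · have h2 : 2 ≤ r.toReal := by
      simpa using (ENNReal.toReal_le_toReal ENNReal.ofNat_ne_top hrt).2 hr
    have h0 : 0 < r.toReal := by linarith
    have e2 : 2 / (1 - (1 - 2 / r.toReal)) = r.toReal := by field_simp; ring
    have hlt : 1 - 2 / r.toReal < 1 := by linarith [div_pos two_pos h0]
    have key := lintegral_DbihamGroup_rpow_le hα0 hα1 ht hθ0 hlt hf hf1 hf2
    rw [e2] at key
    rw [eLpNorm_eq_lintegral_rpow_enorm_toReal (zero_lt_two.trans_le hr).ne' hrt,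
      eLpNorm_eq_lintegral_rpow_enorm_toReal (p := r') (by rw [hr'e]; simpa using hr'p)
        (by rw [hr'e]; exact ENNReal.ofReal_ne_top), hr'e, ENNReal.toReal_ofReal hr'p.le]
    exact key

end Untruncated

/-- Minkowski's integral inequality with a measurable majorant. -/
theorem eLpNorm_integral_le_lintegral {H : ℝ → ℝ → ℂ} (hH : Measurable (Function.uncurry H))
    {r : ℝ≥0∞} (hr : 1 < r) {B : ℝ → ℝ≥0∞} (hB : Measurable B)
    (hHB : ∀ᵐ s, eLpNorm (H s) r volume ≤ B s) :
    eLpNorm (fun x => ∫ s, H s x) r volume ≤ ∫⁻ s, B s := by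
  rcases eq_or_ne r ∞ with rfl | hrt
  · have h1 : ∀ᵐ s, ∀ᵐ x, ‖H s x‖ₑ ≤ B s := by
      filter_upwards [hHB] with s hs
      filter_upwards [enorm_ae_le_eLpNormEssSup (H s) volume] with x hx
      rw [eLpNorm_exponent_top] at hs
      exact hx.trans hs
    have h2 : ∀ᵐ x, ∀ᵐ s, ‖H s x‖ₑ ≤ B s := by
      refine (Measure.ae_ae_comm ?_).1 h1
      exact measurableSet_le hH.enorm (hB.comp measurable_fst)
    rw [eLpNorm_exponent_top]
    refine essSup_le_of_ae_le _ ?_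
    filter_upwards [h2] with x hx
    exact (enorm_integral_le_lintegral_enorm _).trans (lintegral_mono_ae hx)
  · have hr0 : r ≠ 0 := (zero_lt_one.trans hr).ne'
    have hr1 : 1 < r.toReal := by
      simpa using (ENNReal.toReal_lt_toReal ENNReal.one_ne_top hrt).2 hr
    rw [eLpNorm_eq_lintegral_rpow_enorm_toReal hr0 hrt]
    calc (∫⁻ x, ‖∫ s, H s x‖ₑ ^ r.toReal) ^ (1 / r.toReal)
        ≤ (∫⁻ x, (∫⁻ s, ‖H s x‖ₑ) ^ r.toReal) ^ (1 / r.toReal) := by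
          gcongr with x
          exact enorm_integral_le_lintegral_enorm _
      _ ≤ ∫⁻ s, (∫⁻ x, ‖H s x‖ₑ ^ r.toReal) ^ (1 / r.toReal) :=
          lintegral_rpow_lintegral_le volume volume hr1 (G := fun s x => ‖H s x‖ₑ) hH.enorm
      _ ≤ ∫⁻ s, B s := by
          refine lintegral_mono_ae ?_
          filter_upwards [hHB] with s hs
          rwa [eLpNorm_eq_lintegral_rpow_enorm_toReal hr0 hrt] at hs

theorem measurable_eLpNorm_slice {F : ℝ → ℝ → ℂ} (hF : Measurable (Function.uncurry F))
    {p : ℝ≥0∞} (hp0 : p ≠ 0) (hp : p ≠ ∞) : Measurable fun s => eLpNorm (F s) p volume := by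
  simp only [eLpNorm_eq_lintegral_rpow_enorm_toReal hp0 hp]
  exact ((hF.enorm.pow_const _).lintegral_prod_right' (ν := volume)).pow_const _

theorem measurable_DbihamGroup_slice (β t : ℝ) {F : ℝ → ℝ → ℂ}
    (hF : Measurable (Function.uncurry F)) :
    Measurable (Function.uncurry fun s x => DbihamGroup β (t - s) (F s) x) := by
  have h1 : Measurable fun p : ℝ × ℝ => fourierInt (F p.1) p.2 := by
    have : StronglyMeasurable (Function.uncurry fun (p : ℝ × ℝ) (y : ℝ) =>
        cexp (-(I * y * p.2)) * F p.1 y) := by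
      refine Measurable.stronglyMeasurable (Measurable.mul (by fun_prop) ?_)
      exact hF.comp ((measurable_fst.comp measurable_fst).prodMk measurable_snd)
    exact (this.integral_prod_right (ν := volume)).measurable
  have h2 : StronglyMeasurable (Function.uncurry fun (p : ℝ × ℝ) (ξ : ℝ) =>
      ((|ξ| ^ β : ℝ) : ℂ) * cexp (I * (p.2 * ξ + (t - p.1 : ℝ) * ξ ^ 4)) *
        fourierInt (F p.1) ξ) := by
    refine Measurable.stronglyMeasurable (Measurable.mul (by fun_prop) ?_)
    exact h1.comp ((measurable_fst.comp measurable_fst).prodMk measurable_snd)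
  exact ((h2.integral_prod_right (ν := volume)).measurable.const_mul _)

theorem SchwartzMap.integrable_norm_slice_rpow (F : SchwartzMap (ℝ × ℝ) ℂ) (t : ℝ) {s : ℝ}
    (hs : 1 / 2 ≤ s) : Integrable fun y => ‖F (t, y)‖ ^ s := by
  obtain ⟨C, hC0, hC⟩ : ∃ C : ℝ, 0 ≤ C ∧ ∀ y : ℝ, ‖F (t, y)‖ ≤ C * (1 + ‖y‖) ^ (-4 : ℝ) := by
    refine ⟨2 ^ 4 * (Finset.Iic (4, 0)).sup (fun m => SchwartzMap.seminorm ℝ m.1 m.2) F,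
      mul_nonneg (by positivity) (apply_nonneg _ _), fun y => ?_⟩
    have h := SchwartzMap.one_add_le_sup_seminorm_apply (𝕜 := ℝ) (m := (4, 0)) le_rfl le_rfl
      F (t, y)
    rw [norm_iteratedFDeriv_zero] at h
    have h1 : 0 < 1 + ‖y‖ := by positivity
    rw [Real.rpow_neg h1.le, ← div_eq_mul_inv, le_div_iff₀ (by positivity), mul_comm]
    refine le_trans ?_ h
    rw [Real.rpow_ofNat]
    gcongr
    exact le_max_right _ _
  have hm : Measurable fun y => ‖F (t, y)‖ ^ s :=
    (F.continuous.measurable.comp (measurable_const.prodMk measurable_id)).norm.pow_const s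
  refine Integrable.mono' ((integrable_one_add_norm (E := ℝ) (μ := volume) (r := 4 * s)
    (by norm_num; linarith)).const_mul (C ^ s)) hm.aestronglyMeasurable
    (Filter.Eventually.of_forall fun y => ?_)
  have h1 : 0 < 1 + ‖y‖ := by positivity
  rw [Real.norm_of_nonneg (by positivity), show -(4 * s) = -4 * s by ring, Real.rpow_mul h1.le,
    ← Real.mul_rpow hC0 (by positivity)]
  exact Real.rpow_le_rpow (norm_nonneg _) (hC y) (by linarith)

/-- The scaling relation between the time exponent and the dispersive decay rate. -/
theorem Admissible.two_div_toReal {q r : ℝ≥0∞} {α : ℝ} (h : Admissible q r α) :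
    2 / q.toReal = (1 + α) * (1 - 2 / r.toReal) / 4 := by
  obtain ⟨⟨hα0, -⟩, -, -, h⟩ := h
  have hfin : 4 / q + ENNReal.ofReal (1 + α) / r ≠ ∞ := h ▸ ENNReal.ofReal_ne_top
  have h' := congrArg ENNReal.toReal h
  rw [ENNReal.toReal_add (ENNReal.add_ne_top.1 hfin).1 (ENNReal.add_ne_top.1 hfin).2,
    ENNReal.toReal_div, ENNReal.toReal_div, ENNReal.toReal_ofReal (by linarith),
    ENNReal.toReal_ofReal (by linarith), ENNReal.toReal_ofNat] at h'
  linear_combination h' / 2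

theorem enorm_toReal_le (x : ℝ≥0∞) : ‖x.toReal‖ₑ ≤ x := by
  rw [Real.enorm_of_nonneg ENNReal.toReal_nonneg]
  exact ENNReal.ofReal_toReal_le

/-- The retarded evolution is pointwise in time controlled by a fractional integral. -/
theorem eLpNorm_integral_DbihamGroup_le {r r' : ℝ≥0∞} {α : ℝ} (hr : 2 ≤ r)
    (hr' : 1 / r + 1 / r' = 1) (hα0 : 0 ≤ α) (hα1 : α ≤ 1) (F : SchwartzMap (ℝ × ℝ) ℂ) (t : ℝ) :
    eLpNorm (fun x =>
        ∫ s : ℝ, DbihamGroup (α * (1 - 2 / r.toReal)) (t - s) (fun y => F (s, y)) x) r volume ≤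
      ENNReal.ofReal (dispersiveConst (1 - 2 / r.toReal)) *
        ∫⁻ s, rieszKernel ((1 + α) * (1 - 2 / r.toReal) / 4) (t - s) *
          eLpNorm (fun y => F (s, y)) r' volume := by
  obtain ⟨hθ0, -, hr'e⟩ := conjExponent_eq hr hr'
  have hFm : Measurable (Function.uncurry fun s y : ℝ => F (s, y)) := F.continuous.measurable
  have hr'0 : r' ≠ 0 := by
    rw [hr'e, ne_eq, ENNReal.ofReal_eq_zero, not_le]; positivity
  have hn := measurable_eLpNorm_slice hFm hr'0 (by rw [hr'e]; exact ENNReal.ofReal_ne_top)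
  have hk : Measurable fun s => rieszKernel ((1 + α) * (1 - 2 / r.toReal) / 4) (t - s) :=
    (measurable_rieszKernel _).comp (measurable_const.sub measurable_id)
  have hkn := hk.mul hn
  simp only [Pi.mul_def] at hkn
  rw [← lintegral_const_mul _ hkn]
  refine eLpNorm_integral_le_lintegral
    (measurable_DbihamGroup_slice (α * (1 - 2 / r.toReal)) t hFm) (ENNReal.one_lt_two.trans_le hr)
    (hkn.const_mul _) ?_
  filter_upwards [compl_mem_ae_iff.2 (measure_singleton t)] with s hs
  refine (eLpNorm_DbihamGroup_le hr hr' hα0 hα1 (sub_ne_zero.2 (Ne.symm hs))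
    (hFm.comp (measurable_const.prodMk measurable_id))
    fun _ hσ => F.integrable_norm_slice_rpow s hσ).trans_eq ?_
  rw [ENNReal.ofReal_mul (dispersiveConst_pos _).le, mul_assoc]
  rfl

theorem SchwartzMap.eLpNorm_slice_ne_top {r r' : ℝ≥0∞} (hr : 2 ≤ r) (hr' : 1 / r + 1 / r' = 1)
    (F : SchwartzMap (ℝ × ℝ) ℂ) (s : ℝ) : eLpNorm (fun y => F (s, y)) r' volume ≠ ∞ := by
  obtain ⟨hθ0, hθ1, hr'e⟩ := conjExponent_eq hr hr'
  have hp : 0 < 2 / (1 + (1 - 2 / r.toReal)) := by positivity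
  rw [hr'e, eLpNorm_eq_lintegral_rpow_enorm_toReal (by simpa using hp) ENNReal.ofReal_ne_top,
    ENNReal.toReal_ofReal hp.le, ← ofReal_integral_norm_rpow hp (F.integrable_norm_slice_rpow s
      ((div_le_div_iff₀ two_pos (by linarith)).2 (by linarith)))]
  exact ENNReal.rpow_ne_top_of_nonneg (by positivity) ENNReal.ofReal_ne_top

/-- Inhomogeneous (retarded) Strichartz estimate:
`‖∫ D^{α(1-2/r)} e^{i(t-t')∂_x⁴} F(t') dt'‖_{L_t^q L_x^r} ≤ C ‖F‖_{L_t^{q'} L_x^{r'}}`. -/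
theorem stmt_6 (q r : ℝ≥0∞) (α : ℝ) (h : Admissible q r α)
    (q' r' : ℝ≥0∞) (hq' : 1/q + 1/q' = 1) (hr' : 1/r + 1/r' = 1) :
    ∃ C > (0:ℝ), ∀ F : SchwartzMap (ℝ × ℝ) ℂ,
      mixedNorm q r (fun t x =>
          ∫ t' : ℝ, DbihamGroup (α * (1 - 2/r.toReal)) (t - t') (fun y => F (t', y)) x) ≤
        ENNReal.ofReal C * mixedNorm q' r' (fun t x => F (t, x)) := by
  have hscale := h.two_div_toReal
  obtain ⟨⟨hα0, hα1⟩, hr, hq, -⟩ := h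
  set K := dispersiveConst (1 - 2 / r.toReal) with hK
  have hK0 : 0 < K := dispersiveConst_pos _
  have hpt := fun (F : SchwartzMap (ℝ × ℝ) ℂ) t =>
    (enorm_toReal_le _).trans (eLpNorm_integral_DbihamGroup_le hr hr' hα0 hα1 F t)
  rw [← hscale, ← hK] at hpt
  have hn : ∀ (F : SchwartzMap (ℝ × ℝ) ℂ) (s : ℝ),
      ‖(eLpNorm (fun y => F (s, y)) r' volume).toReal‖ₑ = eLpNorm (fun y => F (s, y)) r' volume :=
    fun F s => by
      rw [Real.enorm_of_nonneg ENNReal.toReal_nonneg,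
        ENNReal.ofReal_toReal (F.eLpNorm_slice_ne_top hr hr' s)]
  rcases eq_or_ne q ∞ with rfl | hqt
  · have e1 : q' = 1 := by
      simpa only [one_div, ENNReal.inv_top, zero_add, ENNReal.inv_eq_one] using hq'
    subst e1
    refine ⟨K, hK0, fun F => ?_⟩
    rw [mixedNorm, mixedNorm, eLpNorm_exponent_top, eLpNorm_one_eq_lintegral_enorm]
    refine essSup_le_of_ae_le _ (Filter.Eventually.of_forall fun t => ?_)
    refine (hpt F t).trans_eq ?_
    simp only [hn, rieszKernel, ENNReal.toReal_top, div_zero, neg_zero, Real.rpow_zero,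
      ENNReal.ofReal_one, one_mul]
  · have hq4 : 4 ≤ q.toReal := by
      have h8 : 4 ≤ 8 / (1 + α) := (le_div_iff₀ (by linarith)).2 (by linarith)
      exact h8.trans ((ENNReal.ofReal_le_iff_le_toReal hqt).1 hq)
    have hq0 : q ≠ 0 := by rintro rfl; norm_num at hq4
    have hq'0 : q' ≠ 0 := by rintro rfl; simp at hq'
    have hq't : q' ≠ ∞ := by
      rintro rfl
      simp only [one_div, ENNReal.inv_top, add_zero, ENNReal.inv_eq_one] at hq'
      norm_num [hq'] at hq4
    have hconj : q.toReal.HolderConjugate q'.toReal := by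
      refine Real.holderConjugate_iff.2 ⟨by linarith, ?_⟩
      have := congrArg ENNReal.toReal hq'
      rwa [one_div, one_div, ENNReal.toReal_add (ENNReal.inv_ne_top.2 hq0)
        (ENNReal.inv_ne_top.2 hq'0), ENNReal.toReal_inv, ENNReal.toReal_inv,
        ENNReal.toReal_one] at this
    obtain ⟨C, hC0, hC⟩ := hardy_littlewood_sobolev hconj (by linarith)
    refine ⟨K * (C + 1), by positivity, fun F => ?_⟩
    set n : ℝ → ℝ≥0∞ := fun s => eLpNorm (fun y => F (s, y)) r' volume with hndef
    have hr'e := (conjExponent_eq hr hr').2.2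
    have hnm : Measurable n := by
      refine measurable_eLpNorm_slice (F := fun s y => F (s, y)) F.continuous.measurable ?_
        (by rw [hr'e]; exact ENNReal.ofReal_ne_top)
      rintro rfl
      simp at hr'
    rw [mixedNorm, mixedNorm, eLpNorm_eq_lintegral_rpow_enorm_toReal hq0 hqt,
      eLpNorm_eq_lintegral_rpow_enorm_toReal hq'0 hq't]
    simp only [hn F]
    have hqp : 0 < q.toReal := by linarith
    have hq'p : 0 < q'.toReal := hconj.symm.pos
    by_cases hfin : ∫⁻ s, n s ^ q'.toReal = ∞
    · rw [hfin, ENNReal.top_rpow_of_pos (by positivity), ENNReal.mul_top]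
      · exact le_top
      · rw [ne_eq, ENNReal.ofReal_eq_zero, not_le]; positivity
    · have hkn : Measurable fun t => ∫⁻ s, rieszKernel (2 / q.toReal) (t - s) * n s := by
        refine Measurable.lintegral_prod_right' (ν := volume)
          (f := fun p : ℝ × ℝ => rieszKernel (2 / q.toReal) (p.1 - p.2) * n p.2) ?_
        exact ((measurable_rieszKernel _).comp (measurable_fst.sub measurable_snd)).mul
          (hnm.comp measurable_snd)
      refine (ENNReal.rpow_le_rpow (lintegral_mono fun t =>
        ENNReal.rpow_le_rpow (hpt F t) hqp.le) (by positivity)).trans ?_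
      simp only [ENNReal.mul_rpow_of_nonneg _ _ hqp.le]
      rw [lintegral_const_mul _ (hkn.pow_const _), ENNReal.mul_rpow_of_nonneg _ _ (by positivity),
        ← ENNReal.rpow_mul, mul_one_div_cancel hqp.ne', ENNReal.rpow_one,
        ENNReal.ofReal_mul hK0.le, mul_assoc]
      gcongr
      refine (hC n hnm hfin).trans ?_
      gcongr
      linarith
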